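/- arXiv:2312.12690 — 2 statements merged into one kernel-verified Lean document; each statement's English description precedes it below -/
import Mathlib

section
/- Let a ≥ 0 and b > 0 be real numbers (with the convention 1/Γ(0) = 0 when a = 0), and set p = √((a+1)/b). For each positive integer N set L_N = a·N, n_N = (b+1)·N, δ_N = (n_N + L_N + 1)/(N·(1+p²)²). Fix real numbers s, t, χ and set z_N = p + s/√(N·δ_N), w_N = p + t/√(N·δ_N), λ_N = p + χ/√(N·δ_N). Then lim_{N→∞} q̂_{N−1}^{(n_N,L_N)}(z_N·w_N | λ_N²) · (z_N·w_N)^{L_N} · ((1+z_N²)(1+w_N²))^{−(n_N+L_N+1)/2} = e^{−(s−t)²/2}·F(s+t)/(1+p²), where F(x) = (1/2)·erfc(x/√2) with erfc(x) = (2/√π)·∫_x^∞ e^{−u²} du, and all powers with real exponents are real powers. -/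
open Finset Filter MeasureTheory

noncomputable section

/-- `q_N^{(n,L)}(y)`. -/
def qS (n L : ℝ) (N : ℕ) (y : ℝ) : ℝ :=
  ∑ k ∈ Finset.range (N + 1),
    Real.Gamma (L + n + 1) / (Real.Gamma ((k : ℝ) + L + 1) * Real.Gamma (n + 1 - k)) * y ^ k

/-- `q̂_N^{(n,L)}(y|x)`. -/
def qhat (n L : ℝ) (N : ℕ) (y x : ℝ) : ℝ :=
  qS n L N y + (1 / (n * x - L)) * (Real.Gamma (L + n + 1) / (Real.Gamma (n + 1) * Real.Gamma L))

/-- The complementary error function `erfc(x) = (2/√π) ∫_x^∞ e^{−u²} du`. -/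
def erfc (x : ℝ) : ℝ := (2 / Real.sqrt Real.pi) * ∫ u in Set.Ioi x, Real.exp (-u ^ 2)

/-- `F(x) = (1/2) erfc(x/√2)`. -/
def Ferfc (x : ℝ) : ℝ := erfc (x / Real.sqrt 2) / 2

/-- The truncated binomial-type sum with success probability `x` and real index shift `L`. -/
def binomialTail (n L : ℝ) (N : ℕ) (x : ℝ) : ℝ :=
  ∑ k ∈ Finset.range N,
    Real.Gamma (L + n + 1) / (Real.Gamma ((k : ℝ) + L + 1) * Real.Gamma (n + 1 - k)) *
      (x ^ ((k : ℝ) + L) * (1 - x) ^ (n - k))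

/-- The boundary term of the telescoping derivative of `binomialTail`: a Beta density. -/
def betaTerm (n L : ℝ) (k : ℕ) (x : ℝ) : ℝ :=
  Real.Gamma (L + n + 1) / (Real.Gamma ((k : ℝ) + L) * Real.Gamma (n + 1 - k)) *
    (x ^ ((k : ℝ) + L - 1) * (1 - x) ^ (n - k))

lemma hasDerivAt_binomialTail {n L x : ℝ} {N : ℕ} (hL : 0 ≤ L) (hn : (N : ℝ) ≤ n)
    (hx : x ∈ Set.Ioo (0 : ℝ) 1) :
    HasDerivAt (binomialTail n L N) (betaTerm n L 0 x - betaTerm n L N x) x := by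
  obtain ⟨hx0, hx1⟩ := hx
  have hx1' : 0 < 1 - x := by linarith
  have key : ∀ k ∈ Finset.range N, HasDerivAt (fun x : ℝ =>
      Real.Gamma (L + n + 1) / (Real.Gamma ((k : ℝ) + L + 1) * Real.Gamma (n + 1 - k)) *
      (x ^ ((k : ℝ) + L) * (1 - x) ^ (n - k))) (betaTerm n L k x - betaTerm n L (k + 1) x) x := by
    intro k hk
    have hk' : (k : ℝ) + 1 ≤ N := by exact_mod_cast Finset.mem_range.1 hk
    have hnk : 0 < n - k := by linarith
    have h1 : HasDerivAt (fun x : ℝ => x ^ ((k : ℝ) + L)) (((k : ℝ) + L) * x ^ ((k : ℝ) + L - 1)) x :=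
      Real.hasDerivAt_rpow_const (Or.inl hx0.ne')
    have h2 : HasDerivAt (fun x : ℝ => (1 - x) ^ (n - k))
        (-1 * (n - k) * (1 - x) ^ (n - k - 1)) x :=
      ((hasDerivAt_id x).const_sub 1).rpow_const (Or.inl hx1'.ne')
    refine ((h1.mul h2).const_mul _).congr_deriv ?_
    have e2 : Real.Gamma (n + 1 - k) = (n - k) * Real.Gamma (n - k) := by
      rw [← Real.Gamma_add_one hnk.ne']; ring_nf
    have g2 : Real.Gamma (n - k) ≠ 0 := (Real.Gamma_pos_of_pos hnk).ne'
    have g3 : Real.Gamma ((k : ℝ) + L + 1) ≠ 0 := (Real.Gamma_pos_of_pos (by positivity)).ne'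
    have e3 : Real.Gamma (n + 1 - (k + 1 : ℕ)) = Real.Gamma (n - k) := by
      push_cast; ring_nf
    have e4 : Real.Gamma (((k + 1 : ℕ) : ℝ) + L) = Real.Gamma ((k : ℝ) + L + 1) := by
      push_cast; ring_nf
    have e5 : ((k + 1 : ℕ) : ℝ) + L - 1 = (k : ℝ) + L := by push_cast; ring
    have e6 : n - ((k + 1 : ℕ) : ℝ) = n - k - 1 := by push_cast; ring
    simp only [betaTerm]
    rw [e3, e4, e5, e6, e2]
    rcases eq_or_ne ((k : ℝ) + L) 0 with h0 | h0
    · rw [h0]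
      rw [h0] at g3
      simp only [Real.Gamma_zero]
      field_simp
      ring
    · rw [Real.Gamma_add_one h0] at g3 ⊢
      have g1 : Real.Gamma ((k : ℝ) + L) ≠ 0 := right_ne_zero_of_mul g3
      field_simp
      ring
  have := HasDerivAt.fun_sum key
  rwa [Finset.sum_range_sub' (fun k => betaTerm n L k x)] at this

lemma continuousOn_rpow_mul_one_sub_rpow {x : ℝ} (hx : 0 < x) (p : ℝ) {q : ℝ} (hq : 0 ≤ q) :
    ContinuousOn (fun u : ℝ => u ^ p * (1 - u) ^ q) (Set.Icc x 1) := by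
  refine ContinuousOn.mul ?_ ?_
  · exact continuousOn_id.rpow_const fun u hu => Or.inl (hx.trans_le hu.1).ne'
  · exact (continuousOn_const.sub continuousOn_id).rpow_const fun u _ => Or.inr hq

lemma intervalIntegrable_betaTerm {n L x : ℝ} {k : ℕ} (hn : (k : ℝ) ≤ n)
    (hx : x ∈ Set.Ioo (0 : ℝ) 1) : IntervalIntegrable (betaTerm n L k) volume x 1 := by
  apply ContinuousOn.intervalIntegrable
  rw [Set.uIcc_of_le hx.2.le]
  exact continuousOn_const.mul (continuousOn_rpow_mul_one_sub_rpow hx.1 _ (by linarith))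

lemma binomialTail_eq_integral {n L x : ℝ} {N : ℕ} (hL : 0 ≤ L) (hn : (N : ℝ) ≤ n)
    (hx : x ∈ Set.Ioo (0 : ℝ) 1) :
    binomialTail n L N x = (∫ u in x..1, betaTerm n L N u) - ∫ u in x..1, betaTerm n L 0 u := by
  have hn0 : ((0 : ℕ) : ℝ) ≤ n := by
    have : (0 : ℝ) ≤ N := N.cast_nonneg
    push_cast; linarith
  have i0 := intervalIntegrable_betaTerm (L := L) hn0 hx
  have iN := intervalIntegrable_betaTerm (L := L) hn hx
  have h := intervalIntegral.integral_eq_sub_of_hasDerivAt_of_le (f := binomialTail n L N)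
    (f' := fun u => betaTerm n L 0 u - betaTerm n L N u) hx.2.le ?_
    (fun u hu => hasDerivAt_binomialTail hL hn ⟨hx.1.trans hu.1, hu.2⟩) (i0.sub iN)
  · rw [intervalIntegral.integral_sub i0 iN] at h
    have h1 : binomialTail n L N 1 = 0 := by
      refine Finset.sum_eq_zero fun k hk => ?_
      have hk' : (k : ℝ) + 1 ≤ N := by exact_mod_cast Finset.mem_range.1 hk
      rw [sub_self, Real.zero_rpow (by linarith), mul_zero, mul_zero]
    linarith
  · refine continuousOn_finsetSum _ fun k hk => continuousOn_const.mul ?_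
    have hk' : (k : ℝ) + 1 ≤ N := by exact_mod_cast Finset.mem_range.1 hk
    exact continuousOn_rpow_mul_one_sub_rpow hx.1 _ (by linarith)

lemma integral_rpow_mul_one_sub_rpow {α β : ℝ} (hα : 0 < α) (hβ : 0 < β) :
    ∫ u in Set.Ioo (0 : ℝ) 1, u ^ (α - 1) * (1 - u) ^ (β - 1) =
      Real.Gamma α * Real.Gamma β / Real.Gamma (α + β) := by
  change _ = ProbabilityTheory.beta α β
  have h0 : (0 : ℝ) ≤ ∫ u in Set.Ioo (0 : ℝ) 1, u ^ (α - 1) * (1 - u) ^ (β - 1) :=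
    setIntegral_nonneg measurableSet_Ioo fun u hu =>
      mul_nonneg (Real.rpow_nonneg hu.1.le _) (Real.rpow_nonneg (by linarith [hu.2]) _)
  rw [ProbabilityTheory.beta_eq_betaIntegralReal α β hα hβ, Complex.betaIntegral,
    intervalIntegral.integral_of_le (by norm_num), ← integral_Ioc_eq_integral_Ioo,
    ← RCLike.re_to_complex, ← integral_re]
  · refine setIntegral_congr_fun measurableSet_Ioc fun x ⟨hx1, hx₂⟩ ↦ ?_
    norm_cast
    rw [← Complex.ofReal_cpow, ← Complex.ofReal_cpow, RCLike.re_to_complex,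
      Complex.re_mul_ofReal, Complex.ofReal_re]
    all_goals linarith
  · convert! Complex.betaIntegral_convergent (u := α) (v := β) (by simpa) (by simpa)
    rw [intervalIntegrable_iff_integrableOn_Ioc_of_le (by simp), IntegrableOn]

/-- `log (u / c) ≤ (u - c) / c - (u - c)² / 4` on `(0, 1)`. -/
lemma log_sub_log_le {u c : ℝ} (hu : u ∈ Set.Ioo (0 : ℝ) 1) (hc : c ∈ Set.Ioo (0 : ℝ) 1) :
    Real.log u - Real.log c ≤ (u - c) / c - (u - c) ^ 2 / 4 := by
  obtain ⟨hu0, hu1⟩ := hu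
  obtain ⟨hc0, hc1⟩ := hc
  obtain ⟨r, hr, rfl⟩ : ∃ r : ℝ, 0 < r ∧ u = c * r ^ 2 :=
    ⟨√(u / c), by positivity, by rw [Real.sq_sqrt (by positivity)]; field_simp⟩
  rw [Real.log_mul hc0.ne' (by positivity), Real.log_pow]
  have h1 := Real.log_le_sub_one_of_pos hr
  have h2 : (c * r ^ 2 - c) / c = r ^ 2 - 1 := by field_simp
  rw [h2]
  have h3 : (c * (r + 1)) ^ 2 ≤ 4 := by nlinarith [mul_pos hc0 hr, sq_nonneg (c * r - c)]
  have h4 : (c * r ^ 2 - c) ^ 2 = (c * (r + 1)) ^ 2 * (r - 1) ^ 2 := by ring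
  rw [h4]
  push_cast
  nlinarith [sq_nonneg (r - 1)]

/-- `log` of `u ^ A * (1 - u) ^ b`, normalised by its value at the mode `A / (A + b)`. -/
def logBeta (A b u : ℝ) : ℝ :=
  A * (Real.log u - Real.log (A / (A + b))) + b * (Real.log (1 - u) - Real.log (b / (A + b)))

lemma logBeta_le {A b u : ℝ} (hA : 0 < A) (hb : 0 < b) (hu : u ∈ Set.Ioo (0 : ℝ) 1) :
    logBeta A b u ≤ -((A + b) / 4 * (u - A / (A + b)) ^ 2) := by
  have hAb : 0 < A + b := by positivity
  have h1 := log_sub_log_le hu (c := A / (A + b))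
    ⟨by positivity, by rw [div_lt_one hAb]; linarith⟩
  have h2 := log_sub_log_le (u := 1 - u) ⟨by linarith [hu.2], by linarith [hu.1]⟩ (c := b / (A + b))
    ⟨by positivity, by rw [div_lt_one hAb]; linarith⟩
  have e1 : (1 - u) - b / (A + b) = -(u - A / (A + b)) := by field_simp; ring
  rw [e1] at h2
  have e2 : A * ((u - A / (A + b)) / (A / (A + b))) = (A + b) * (u - A / (A + b)) := by
    field_simp
  have e3 : b * (-(u - A / (A + b)) / (b / (A + b))) = -((A + b) * (u - A / (A + b))) := by
    field_simp
  have h1' := mul_le_mul_of_nonneg_left h1 hA.le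
  have h2' := mul_le_mul_of_nonneg_left h2 hb.le
  unfold logBeta
  nlinarith

/-- Second-order expansion of `log (1 + x)` along `x = α / √N`. -/
lemma tendsto_mul_log_one_add_div_sqrt (α : ℝ) :
    Tendsto (fun N : ℕ => (N : ℝ) * (Real.log (1 + α / √N) - α / √N)) atTop
      (nhds (-α ^ 2 / 2)) := by
  have hs : Tendsto (fun N : ℕ => √(N : ℝ)) atTop atTop :=
    Real.tendsto_sqrt_atTop.comp tendsto_natCast_atTop_atTop
  have h0 : Tendsto (fun N : ℕ => |α| / √(N : ℝ)) atTop (nhds 0) := hs.const_div_atTop _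
  rw [tendsto_iff_norm_sub_tendsto_zero]
  have hb : Tendsto (fun N : ℕ => α ^ 2 * (2 * (|α| / √(N : ℝ)))) atTop (nhds 0) := by
    simpa using (h0.const_mul 2).const_mul (α ^ 2)
  refine squeeze_zero' (Eventually.of_forall fun _ => norm_nonneg _) ?_ hb
  filter_upwards [h0.eventually (gt_mem_nhds (show (0 : ℝ) < 1 / 2 by norm_num)),
    eventually_gt_atTop 0] with N hN hN0
  have hNpos : (0 : ℝ) < N := by exact_mod_cast hN0
  have hsp : 0 < √(N : ℝ) := Real.sqrt_pos.2 hNpos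
  set y : ℝ := α / √(N : ℝ) with hy
  have hyabs : |-y| = |α| / √(N : ℝ) := by rw [abs_neg, hy, abs_div, abs_of_pos hsp]
  have hlt : |-y| < 1 / 2 := by rw [hyabs]; exact hN
  have h := Real.abs_log_sub_add_sum_range_le (x := -y) (by linarith) 2
  have hα : α ^ 2 = N * y ^ 2 := by
    rw [hy, div_pow, Real.sq_sqrt hNpos.le]; field_simp
  rw [Real.norm_eq_abs, hα, ← hyabs]
  have e : (N : ℝ) * (Real.log (1 + y) - y) - -(N * y ^ 2) / 2 =
      N * ((∑ i ∈ Finset.range 2, (-y) ^ (i + 1) / ((i : ℝ) + 1)) + Real.log (1 - -y)) := by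
    simp [Finset.sum_range_succ]; ring
  rw [e, abs_mul, abs_of_pos hNpos, mul_assoc]
  refine mul_le_mul_of_nonneg_left (h.trans ?_) hNpos.le
  rw [div_le_iff₀ (by linarith)]
  have : y ^ 2 = |-y| ^ 2 := by rw [sq_abs]; ring
  rw [this]
  have h3 : 0 ≤ |-y| ^ 3 * (1 - 2 * |-y|) :=
    mul_nonneg (pow_nonneg (abs_nonneg _) 3) (by linarith)
  have h4 : |-y| ^ 2 * (2 * |-y|) * (1 - |-y|) - |-y| ^ (2 + 1) = |-y| ^ 3 * (1 - 2 * |-y|) := by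
    ring
  exact sub_nonneg.1 (h4 ▸ h3)

/-- Local Gaussian behaviour of `logBeta` at its maximum. -/
lemma tendsto_mul_logBeta {A b : ℝ} (hA : 0 < A) (hb : 0 < b) (v : ℝ) :
    Tendsto (fun N : ℕ => (N : ℝ) * logBeta A b (A / (A + b) + v / √N)) atTop
      (nhds (-((A + b) ^ 3 / (2 * A * b)) * v ^ 2)) := by
  have hAb : 0 < A + b := by positivity
  have hs : Tendsto (fun N : ℕ => √(N : ℝ)) atTop atTop :=
    Real.tendsto_sqrt_atTop.comp tendsto_natCast_atTop_atTop
  have h1 := (tendsto_mul_log_one_add_div_sqrt (v * (A + b) / A)).const_mul A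
  have h2 := (tendsto_mul_log_one_add_div_sqrt (-(v * (A + b) / b))).const_mul b
  have h := h1.add h2
  have e : A * (-(v * (A + b) / A) ^ 2 / 2) + b * (-(-(v * (A + b) / b)) ^ 2 / 2) =
      -((A + b) ^ 3 / (2 * A * b)) * v ^ 2 := by field_simp; ring
  rw [e] at h
  refine h.congr' ?_
  have t1 : ∀ α : ℝ, ∀ᶠ N : ℕ in atTop, 0 < 1 + α / √(N : ℝ) := fun α => by
    have : Tendsto (fun N : ℕ => 1 + α / √(N : ℝ)) atTop (nhds (1 + 0)) :=
      (hs.const_div_atTop α).const_add 1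
    exact this.eventually (lt_mem_nhds (by norm_num))
  filter_upwards [t1 (v * (A + b) / A), t1 (-(v * (A + b) / b)), eventually_gt_atTop 0]
    with N h1 h2 hN0
  have hsp : 0 < √(N : ℝ) := Real.sqrt_pos.2 (by exact_mod_cast hN0)
  have e1 : A / (A + b) + v / √(N : ℝ) = A / (A + b) * (1 + v * (A + b) / A / √(N : ℝ)) := by
    field_simp
  have e2 : 1 - (A / (A + b) + v / √(N : ℝ)) =
      b / (A + b) * (1 + -(v * (A + b) / b) / √(N : ℝ)) := by
    field_simp; ring
  unfold logBeta
  rw [e2, e1, Real.log_mul (by positivity) h1.ne', Real.log_mul (by positivity) h2.ne']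
  have e3 : A * (v * (A + b) / A / √(N : ℝ)) + b * (-(v * (A + b) / b) / √(N : ℝ)) = 0 := by
    field_simp; ring
  linear_combination (-(N : ℝ)) * e3

/-- The normalised Beta integrand `u⁻¹ (u ^ A (1 - u) ^ b / max) ^ N` on `(0, 1)`. -/
def betaKernel (A b : ℝ) (N : ℕ) : ℝ → ℝ :=
  (Set.Ioo (0 : ℝ) 1).indicator fun u => u⁻¹ * Real.exp (N * logBeta A b u)

lemma measurable_betaKernel (A b : ℝ) (N : ℕ) : Measurable (betaKernel A b N) := by
  unfold betaKernel logBeta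
  exact Measurable.indicator (by fun_prop) measurableSet_Ioo

lemma betaKernel_nonneg (A b : ℝ) (N : ℕ) (u : ℝ) : 0 ≤ betaKernel A b N u :=
  Set.indicator_nonneg (fun _ hu => mul_nonneg (inv_nonneg.2 hu.1.le) (Real.exp_nonneg _)) _

lemma betaKernel_le {A b : ℝ} (hA : 1 ≤ A) (hb : 0 < b) {N : ℕ} (hN : 2 ≤ N) (v : ℝ) :
    betaKernel A b N (A / (A + b) + v / √N) ≤
      Real.exp (-(A * Real.log (A / (A + b)) + b * Real.log (b / (A + b)))) *
        Real.exp (-((A + b) / 8) * v ^ 2) := by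
  unfold betaKernel
  set u : ℝ := A / (A + b) + v / √N with hu
  by_cases h : u ∈ Set.Ioo (0 : ℝ) 1
  swap
  · rw [Set.indicator_of_notMem h]; positivity
  rw [Set.indicator_of_mem h, ← Real.exp_log (inv_pos.2 h.1), ← Real.exp_add, ← Real.exp_add,
    Real.exp_le_exp, Real.log_inv]
  have hN' : (2 : ℝ) ≤ N := by exact_mod_cast hN
  have h1 : -Real.log u + logBeta A b u ≤
      -(A * Real.log (A / (A + b)) + b * Real.log (b / (A + b))) := by
    have l1 : Real.log u ≤ 0 := Real.log_nonpos h.1.le h.2.le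
    have l2 : Real.log (1 - u) ≤ 0 := Real.log_nonpos (by linarith [h.2]) (by linarith [h.1])
    unfold logBeta
    nlinarith [mul_nonneg (sub_nonneg.2 hA) (neg_nonneg.2 l1), mul_nonneg hb.le (neg_nonneg.2 l2)]
  have h2 := logBeta_le (A := A) (by linarith) hb h
  have e : u - A / (A + b) = v / √N := by rw [hu]; ring
  rw [e, div_pow, Real.sq_sqrt (by positivity)] at h2
  have h3 : ((N : ℝ) - 1) * logBeta A b u ≤ -((A + b) / 8) * v ^ 2 := by
    refine (mul_le_mul_of_nonneg_left h2 (by linarith)).trans ?_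
    have hp : 0 ≤ (A + b) / 8 * v ^ 2 := by positivity
    have : ((N : ℝ) - 1) * -((A + b) / 4 * (v ^ 2 / N)) =
      -((A + b) / 8 * v ^ 2) * (2 * (N - 1) / N) := by field_simp; ring
    rw [this]
    have : 1 ≤ 2 * ((N : ℝ) - 1) / N := by rw [le_div_iff₀ (by linarith)]; linarith
    nlinarith
  linarith

/-- Laplace's method for the Beta kernel, restricted to sets converging after rescaling. -/
lemma tendsto_sqrt_mul_integral_betaKernel {A b : ℝ} (hA : 1 ≤ A) (hb : 0 < b)
    {S : ℕ → Set ℝ} {T : Set ℝ} (hS : ∀ N, MeasurableSet (S N)) (hT : MeasurableSet T)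
    (hST : ∀ᵐ v : ℝ, ∀ᶠ N : ℕ in atTop, (A / (A + b) + v / √N ∈ S N ↔ v ∈ T)) :
    Tendsto (fun N : ℕ => √(N : ℝ) * ∫ u in S N, betaKernel A b N u) atTop
      (nhds (∫ v in T, (A / (A + b))⁻¹ * Real.exp (-((A + b) ^ 3 / (2 * A * b)) * v ^ 2))) := by
  have hA0 : 0 < A := by linarith
  have hAb : 0 < A + b := by positivity
  have hs : Tendsto (fun N : ℕ => √(N : ℝ)) atTop atTop :=
    Real.tendsto_sqrt_atTop.comp tendsto_natCast_atTop_atTop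
  have hint : ∀ N : ℕ, √(N : ℝ) * ∫ u in S N, betaKernel A b N u =
      ∫ v : ℝ, (S N).indicator (betaKernel A b N) (A / (A + b) + v / √N) := by
    intro N
    rw [Measure.integral_comp_div (fun w => (S N).indicator (betaKernel A b N) (A / (A + b) + w)),
      integral_add_left_eq_self, integral_indicator (hS N), abs_of_nonneg (Real.sqrt_nonneg _),
      smul_eq_mul]
  simp_rw [hint]
  rw [← integral_indicator hT]
  refine tendsto_integral_filter_of_dominated_convergence (fun v =>
      Real.exp (-(A * Real.log (A / (A + b)) + b * Real.log (b / (A + b)))) *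
        Real.exp (-((A + b) / 8) * v ^ 2)) ?_ ?_ ?_ ?_
  · refine Eventually.of_forall fun N => Measurable.aestronglyMeasurable ?_
    exact ((measurable_betaKernel A b N).indicator (hS N)).comp (by fun_prop)
  · filter_upwards [eventually_ge_atTop 2] with N hN
    refine Eventually.of_forall fun v => ?_
    refine (norm_indicator_le_norm_self _ _).trans ?_
    rw [Real.norm_of_nonneg (betaKernel_nonneg _ _ _ _)]
    exact betaKernel_le hA hb hN v
  · exact (integrable_exp_neg_mul_sq (by positivity)).const_mul _
  · filter_upwards [hST] with v hv
    have hu : Tendsto (fun N : ℕ => A / (A + b) + v / √(N : ℝ)) atTop (nhds (A / (A + b))) := by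
      simpa using (hs.const_div_atTop v).const_add (A / (A + b))
    have hmem : ∀ᶠ N : ℕ in atTop, A / (A + b) + v / √(N : ℝ) ∈ Set.Ioo (0 : ℝ) 1 :=
      hu.eventually (Ioo_mem_nhds (by positivity) (by rw [div_lt_one hAb]; linarith))
    by_cases hvT : v ∈ T
    · rw [Set.indicator_of_mem hvT]
      refine Tendsto.congr' ?_ ((hu.inv₀ (by positivity)).mul
        ((Real.continuous_exp.tendsto _).comp (tendsto_mul_logBeta hA0 hb v)))
      filter_upwards [hv, hmem] with N h1 h2
      rw [Set.indicator_of_mem (h1.2 hvT), betaKernel, Set.indicator_of_mem h2]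
      rfl
    · rw [Set.indicator_of_notMem hvT]
      refine tendsto_const_nhds.congr' ?_
      filter_upwards [hv] with N h1
      rw [Set.indicator_of_notMem (fun h => hvT (h1.1 h))]

/-- The Gaussian tail ratio expressed by the complementary error function. -/
lemma gaussian_tail_ratio {κ : ℝ} (hκ : 0 < κ) {c : ℝ} (hc : c ≠ 0) (ξ : ℝ) :
    (∫ v in Set.Ioi ξ, c * Real.exp (-κ * v ^ 2)) / (∫ v : ℝ, c * Real.exp (-κ * v ^ 2)) =
      (1 / √Real.pi) * ∫ u in Set.Ioi (√κ * ξ), Real.exp (-u ^ 2) := by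
  have hsκ : 0 < √κ := Real.sqrt_pos.2 hκ
  have h := integral_comp_mul_left_Ioi (fun u : ℝ => Real.exp (-u ^ 2)) ξ hsκ
  have e : ∀ v : ℝ, Real.exp (-(√κ * v) ^ 2) = Real.exp (-κ * v ^ 2) := fun v => by
    rw [mul_pow, Real.sq_sqrt hκ.le]; ring_nf
  simp_rw [e, smul_eq_mul] at h
  rw [integral_const_mul, integral_const_mul, integral_gaussian, mul_div_mul_left _ _ hc, h,
    Real.sqrt_div Real.pi_pos.le]
  have : 0 < √Real.pi := Real.sqrt_pos.2 Real.pi_pos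
  field_simp

lemma rpow_mul_rpow_strictAnti {a B u u' : ℝ} (ha : 0 < a) (hB : 0 < B) (hu : a / (a + B) ≤ u)
    (huu' : u < u') (hu' : u' ≤ 1) : u' ^ a * (1 - u') ^ B < u ^ a * (1 - u) ^ B := by
  have hu0 : 0 < u := lt_of_lt_of_le (by positivity) hu
  have hu1 : 0 < 1 - u := by linarith
  rcases hu'.eq_or_lt with rfl | hlt
  · rw [sub_self, Real.zero_rpow hB.ne', mul_zero]
    positivity
  have hu'0 : 0 < u' := hu0.trans huu'
  have hu'1 : 0 < 1 - u' := by linarith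
  rw [← Real.log_lt_log_iff (by positivity) (by positivity),
    Real.log_mul (by positivity) (by positivity), Real.log_mul (by positivity) (by positivity),
    Real.log_rpow hu0, Real.log_rpow hu'0, Real.log_rpow hu1, Real.log_rpow hu'1]
  have h1 := Real.log_lt_sub_one_of_pos (x := u' / u) (by positivity)
    (by rw [Ne, div_eq_one_iff_eq hu0.ne']; exact huu'.ne')
  have h2 := Real.log_le_sub_one_of_pos (x := (1 - u') / (1 - u)) (by positivity)
  rw [Real.log_div hu'0.ne' hu0.ne'] at h1
  rw [Real.log_div hu'1.ne' hu1.ne'] at h2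
  have h3 : a * (u' / u - 1) + B * ((1 - u') / (1 - u) - 1) ≤ 0 := by
    have : a * (u' / u - 1) + B * ((1 - u') / (1 - u) - 1) =
        (u' - u) * (a - (a + B) * u) / (u * (1 - u)) := by field_simp; ring
    rw [this]
    rw [div_le_iff₀ (by positivity)] at hu
    exact div_nonpos_of_nonpos_of_nonneg
      (mul_nonpos_of_nonneg_of_nonpos (by linarith) (by linarith)) (by positivity)
  nlinarith [mul_lt_mul_of_pos_left h1 ha, mul_le_mul_of_nonneg_left h2 hB.le]

lemma rpow_mul_one_sub_rpow_eq {a B u : ℝ} (hu : 0 < u) (hu1 : u ≤ 1) (N : ℕ) :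
    u ^ (a * N - 1) * (1 - u) ^ (B * N) = u⁻¹ * (u ^ a * (1 - u) ^ B) ^ N := by
  rw [Real.rpow_sub hu, Real.rpow_one, Real.rpow_mul_natCast hu.le,
    Real.rpow_mul_natCast (by linarith), mul_pow]
  ring

/-- The reciprocal Beta function is exponentially beaten away from the mode. -/
lemma tendsto_gamma_ratio_mul_pow {a B w : ℝ} (ha : 0 < a) (hB : 0 < B) (hw : a / (a + B) < w)
    (hw1 : w ≤ 1) :
    Tendsto (fun N : ℕ => Real.Gamma (a * N + B * N + 1) /
      (Real.Gamma (B * N + 1) * Real.Gamma (a * N)) * (w ^ a * (1 - w) ^ B) ^ N) atTop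
      (nhds 0) := by
  have haB : 0 < a / (a + B) := by positivity
  obtain ⟨v, hv, hvw⟩ := exists_between hw
  have hv0 : 0 < v := haB.trans hv
  have hv1 : v < 1 := hvw.trans_le hw1
  set K : ℝ → ℝ := fun u => u ^ a * (1 - u) ^ B with hK
  have hKv : 0 < K v := mul_pos (Real.rpow_pos_of_pos hv0 _) (Real.rpow_pos_of_pos (by linarith) _)
  have hKw : 0 ≤ K w := mul_nonneg (Real.rpow_nonneg (hv0.trans hvw).le _)
    (Real.rpow_nonneg (by linarith) _)
  have hlt : K w < K v := rpow_mul_rpow_strictAnti ha hB hv.le hvw hw1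
  have hlim : Tendsto (fun N : ℕ => (v - a / (a + B))⁻¹ * (K w / K v) ^ N) atTop (nhds 0) := by
    simpa using (tendsto_pow_atTop_nhds_zero_of_lt_one (div_nonneg hKw hKv.le)
      ((div_lt_one hKv).2 hlt)).const_mul (v - a / (a + B))⁻¹
  refine squeeze_zero' ?_ ?_ hlim
  · filter_upwards [eventually_gt_atTop 0] with N hN
    have hN' : (0 : ℝ) < N := by exact_mod_cast hN
    have := Real.Gamma_pos_of_pos (show 0 < a * N + B * N + 1 by positivity)
    have := Real.Gamma_pos_of_pos (show 0 < B * N + 1 by positivity)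
    have := Real.Gamma_pos_of_pos (show 0 < a * N by positivity)
    exact mul_nonneg (by positivity) (pow_nonneg hKw _)
  · filter_upwards [eventually_gt_atTop 0] with N hN
    have hN' : (0 : ℝ) < N := by exact_mod_cast hN
    have g1 := Real.Gamma_pos_of_pos (show 0 < a * N + B * N + 1 by positivity)
    have g2 := Real.Gamma_pos_of_pos (show 0 < B * N + 1 by positivity)
    have g3 := Real.Gamma_pos_of_pos (show 0 < a * N by positivity)
    have hI := integral_rpow_mul_one_sub_rpow (α := a * N) (β := B * N + 1)
      (by positivity) (by positivity)
    rw [add_sub_cancel_right, ← add_assoc] at hI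
    have hlow : (v - a / (a + B)) * K v ^ N ≤
        Real.Gamma (a * N) * Real.Gamma (B * N + 1) / Real.Gamma (a * N + B * N + 1) := by
      have hi : IntegrableOn (fun u : ℝ => u ^ (a * N - 1) * (1 - u) ^ (B * N))
          (Set.Ioo 0 1) := by
        by_contra hni
        rw [integral_undef hni] at hI
        have : 0 < Real.Gamma (a * N) * Real.Gamma (B * N + 1) / Real.Gamma (a * N + B * N + 1) := by
          positivity
        linarith
      have hsub : Set.Ioo (a / (a + B)) v ⊆ Set.Ioo 0 1 := Set.Ioo_subset_Ioo haB.le hv1.le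
      rw [← hI]
      calc (v - a / (a + B)) * K v ^ N = ∫ _ in Set.Ioo (a / (a + B)) v, K v ^ N := by
            rw [setIntegral_const, smul_eq_mul, measureReal_def, Real.volume_Ioo,
              ENNReal.toReal_ofReal (by linarith)]
        _ ≤ ∫ u in Set.Ioo (a / (a + B)) v, u ^ (a * N - 1) * (1 - u) ^ (B * N) := by
            refine setIntegral_mono_on (integrableOn_const (by simp)) (hi.mono_set hsub)
              measurableSet_Ioo fun u hu => ?_
            have hu0 := hsub hu
            rw [rpow_mul_one_sub_rpow_eq hu0.1 hu0.2.le]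
            have h1 : K v ≤ K u := (rpow_mul_rpow_strictAnti ha hB hu.1.le hu.2 hv1.le).le
            have h2 : K v ^ N ≤ K u ^ N := pow_le_pow_left₀ hKv.le h1 _
            have h3 : 1 ≤ u⁻¹ := (one_le_inv₀ hu0.1).2 hu0.2.le
            have h4 : 0 ≤ K v ^ N := by positivity
            change K v ^ N ≤ u⁻¹ * K u ^ N
            nlinarith
        _ ≤ ∫ u in Set.Ioo 0 1, u ^ (a * N - 1) * (1 - u) ^ (B * N) := by
            refine setIntegral_mono_set hi ?_ hsub.eventuallyLE
            exact ae_restrict_of_forall_mem measurableSet_Ioo fun u hu =>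
              mul_nonneg (Real.rpow_nonneg hu.1.le _) (Real.rpow_nonneg (by linarith [hu.2]) _)
    have hvp : 0 < v - a / (a + B) := by linarith
    have hkvN : 0 < K v ^ N := by positivity
    rw [le_div_iff₀ g1] at hlow
    change _ * K w ^ N ≤ _
    rw [div_pow, ← div_eq_inv_mul, div_div, div_mul_eq_mul_div, div_le_div_iff₀ (by positivity)
      (by positivity)]
    have := mul_le_mul_of_nonneg_left hlow (pow_nonneg hKw N)
    linarith

/-- The lower-index boundary density contributes nothing beyond its own mode. -/
lemma tendsto_integral_betaTerm_zero {a B w : ℝ} (ha : 0 ≤ a) (hB : 0 < B)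
    (hw : a / (a + B) < w) {x : ℕ → ℝ} (hx : ∀ᶠ N in atTop, x N ∈ Set.Ioo w 1) :
    Tendsto (fun N : ℕ => ∫ u in (x N)..1, betaTerm (B * N) (a * N) 0 u) atTop (nhds 0) := by
  have haB : 0 ≤ a / (a + B) := by positivity
  have hw0 : 0 < w := haB.trans_lt hw
  rcases ha.eq_or_lt with rfl | ha
  · simp [betaTerm]
  have hw1 : w < 1 := by
    obtain ⟨N, hN⟩ := hx.exists
    exact hN.1.trans hN.2
  have hlim := (tendsto_gamma_ratio_mul_pow ha hB hw hw1.le).const_mul w⁻¹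
  rw [mul_zero] at hlim
  refine squeeze_zero_norm' ?_ hlim
  filter_upwards [hx, eventually_gt_atTop 0] with N hN hN0
  have hN' : (0 : ℝ) < N := by exact_mod_cast hN0
  have g1 := Real.Gamma_pos_of_pos (show 0 < a * N + B * N + 1 by positivity)
  have g2 := Real.Gamma_pos_of_pos (show 0 < B * N + 1 by positivity)
  have g3 := Real.Gamma_pos_of_pos (show 0 < a * N by positivity)
  set K : ℝ → ℝ := fun u => u ^ a * (1 - u) ^ B with hK
  have hKw : 0 ≤ K w := mul_nonneg (Real.rpow_nonneg hw0.le _)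
    (Real.rpow_nonneg (by linarith) _)
  have hb : ∀ u ∈ Set.uIoc (x N) 1, ‖betaTerm (B * N) (a * N) 0 u‖ ≤
      w⁻¹ * (Real.Gamma (a * N + B * N + 1) /
      (Real.Gamma (B * N + 1) * Real.Gamma (a * N)) * K w ^ N) := by
    intro u hu
    rw [Set.uIoc_of_le hN.2.le] at hu
    have hwu : w < u := hN.1.trans hu.1
    have hu0 : 0 < u := hw0.trans hwu
    have e : betaTerm (B * N) (a * N) 0 u = Real.Gamma (a * N + B * N + 1) /
      (Real.Gamma (B * N + 1) * Real.Gamma (a * N)) * (u⁻¹ * K u ^ N) := by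
      rw [← rpow_mul_one_sub_rpow_eq hu0 hu.2]
      simp only [betaTerm, Nat.cast_zero, zero_add, sub_zero]
      rw [mul_comm (Real.Gamma (a * N))]
    have hKu : 0 ≤ K u := mul_nonneg (Real.rpow_nonneg hu0.le _)
      (Real.rpow_nonneg (by linarith [hu.2]) _)
    have h1 : K u ≤ K w := (rpow_mul_rpow_strictAnti ha hB hw.le hwu hu.2).le
    have h2 : K u ^ N ≤ K w ^ N := pow_le_pow_left₀ hKu h1 _
    have h3 : u⁻¹ ≤ w⁻¹ := inv_anti₀ hw0 hwu.le
    rw [e, Real.norm_of_nonneg (by positivity), mul_left_comm]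
    gcongr
  refine (intervalIntegral.norm_integral_le_of_norm_le_const hb).trans ?_
  refine mul_le_of_le_one_right (by positivity) ?_
  rw [abs_of_pos (by linarith [hN.2])]
  linarith [hN.1]

lemma tendsto_gamma_ratio_mul_rpow {a B w : ℝ} (ha : 0 ≤ a) (hB : 0 < B)
    (hw : a / (a + B) < w) {x : ℕ → ℝ} (hx : ∀ᶠ N in atTop, x N ∈ Set.Ioo w 1) :
    Tendsto (fun N : ℕ => Real.Gamma (a * N + B * N + 1) /
      (Real.Gamma (B * N + 1) * Real.Gamma (a * N)) *
        (x N ^ (a * N) * (1 - x N) ^ (B * N))) atTop (nhds 0) := by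
  have haB : 0 ≤ a / (a + B) := by positivity
  have hw0 : 0 < w := haB.trans_lt hw
  rcases ha.eq_or_lt with rfl | ha
  · simp
  have hw1 : w < 1 := by
    obtain ⟨N, hN⟩ := hx.exists
    exact hN.1.trans hN.2
  refine squeeze_zero_norm' ?_ (tendsto_gamma_ratio_mul_pow ha hB hw hw1.le)
  filter_upwards [hx, eventually_gt_atTop 0] with N hN hN0
  have hN' : (0 : ℝ) < N := by exact_mod_cast hN0
  have g1 := Real.Gamma_pos_of_pos (show 0 < a * N + B * N + 1 by positivity)
  have g2 := Real.Gamma_pos_of_pos (show 0 < B * N + 1 by positivity)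
  have g3 := Real.Gamma_pos_of_pos (show 0 < a * N by positivity)
  have hx0 : 0 < x N := hw0.trans hN.1
  have hx1 : 0 < 1 - x N := by linarith [hN.2]
  rw [Real.norm_of_nonneg (by positivity), Real.rpow_mul_natCast hx0.le,
    Real.rpow_mul_natCast hx1.le, ← mul_pow]
  exact mul_le_mul_of_nonneg_left (pow_le_pow_left₀ (by positivity)
    (rpow_mul_rpow_strictAnti ha hB hw.le hN.1 hN.2.le).le N) (by positivity)

/-- The upper boundary integral as a ratio of Beta kernel integrals. -/
lemma integral_betaTerm_eq_ratio {a b x : ℝ} (ha : 0 ≤ a) (hb : 0 < b) {N : ℕ} (hN : 0 < N)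
    (hx : x ∈ Set.Ioo (0 : ℝ) 1) :
    ∫ u in x..1, betaTerm ((b + 1) * N) (a * N) N u =
      (∫ u in Set.Ioi x, betaKernel (a + 1) b N u) / ∫ u in Set.univ, betaKernel (a + 1) b N u := by
  have hN' : (0 : ℝ) < N := by exact_mod_cast hN
  set A : ℝ := a + 1 with hA
  have hA0 : 0 < A := by positivity
  set C : ℝ := Real.exp (N * (A * Real.log (A / (A + b)) + b * Real.log (b / (A + b)))) with hC
  have hker : ∀ u ∈ Set.Ioo (0 : ℝ) 1,
      u ^ (A * N - 1) * (1 - u) ^ (b * N) = C * betaKernel A b N u := by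
    intro u hu
    have hu1 : 0 < 1 - u := by linarith [hu.2]
    rw [betaKernel, Set.indicator_of_mem hu, Real.rpow_sub hu.1, Real.rpow_one,
      Real.rpow_def_of_pos hu.1, Real.rpow_def_of_pos hu1, div_mul_eq_mul_div, ← Real.exp_add,
      mul_left_comm C, hC, ← Real.exp_add, div_eq_inv_mul]
    congr 2
    unfold logBeta
    ring
  have hI := integral_rpow_mul_one_sub_rpow (α := A * N) (β := b * N + 1)
    (by positivity) (by positivity)
  rw [add_sub_cancel_right, setIntegral_congr_fun measurableSet_Ioo hker, integral_const_mul] at hI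
  have huniv : ∫ u in Set.Ioo (0 : ℝ) 1, betaKernel A b N u =
      ∫ u in Set.univ, betaKernel A b N u := by
    rw [setIntegral_univ, betaKernel, setIntegral_indicator measurableSet_Ioo, Set.inter_self,
      integral_indicator measurableSet_Ioo]
  have hIoi : ∫ u in Set.Ioi x, betaKernel A b N u = ∫ u in Set.Ioo x 1, betaKernel A b N u := by
    rw [betaKernel, setIntegral_indicator measurableSet_Ioo,
      setIntegral_indicator measurableSet_Ioo]
    congr 2
    ext u
    simp only [Set.mem_inter_iff, Set.mem_Ioi, Set.mem_Ioo]
    constructor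
    · rintro ⟨h1, h2, h3⟩; exact ⟨⟨h1, h3⟩, h2, h3⟩
    · rintro ⟨⟨h1, h3⟩, h2, -⟩; exact ⟨h1, h2, h3⟩
  have hC0 : 0 < C := Real.exp_pos _
  rw [hIoi, ← huniv, intervalIntegral.integral_of_le hx.2.le, integral_Ioc_eq_integral_Ioo]
  have g1 := Real.Gamma_pos_of_pos (show 0 < A * N + (b * N + 1) by positivity)
  have g2 := Real.Gamma_pos_of_pos (show 0 < b * N + 1 by positivity)
  have g3 := Real.Gamma_pos_of_pos (show 0 < A * N by positivity)
  have hbt : ∀ u ∈ Set.Ioo x 1, betaTerm ((b + 1) * N) (a * N) N u =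
      Real.Gamma (A * N + (b * N + 1)) / (Real.Gamma (A * N) * Real.Gamma (b * N + 1)) * C *
        betaKernel A b N u := by
    intro u hu
    rw [mul_assoc _ C, ← hker u ⟨hx.1.trans hu.1, hu.2⟩, betaTerm, hA]
    ring_nf
  rw [setIntegral_congr_fun measurableSet_Ioo hbt, integral_const_mul]
  have hpos : 0 < ∫ u in Set.Ioo (0 : ℝ) 1, betaKernel A b N u := by
    have : 0 < C * ∫ u in Set.Ioo (0 : ℝ) 1, betaKernel A b N u := by rw [hI]; positivity
    exact (mul_pos_iff_of_pos_left hC0).1 this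
  rw [eq_div_iff hpos.ne', mul_right_comm, mul_assoc _ C, hI]
  field_simp

/-- The Beta tail integral converges to the Gaussian tail. -/
lemma tendsto_integral_betaTerm {a b : ℝ} (ha : 0 ≤ a) (hb : 0 < b) {x : ℕ → ℝ} {ξ : ℝ}
    (hx : ∀ᶠ N in atTop, x N ∈ Set.Ioo (0 : ℝ) 1)
    (hξ : Tendsto (fun N : ℕ => √(N : ℝ) * (x N - (a + 1) / (a + 1 + b))) atTop (nhds ξ)) :
    Tendsto (fun N : ℕ => ∫ u in (x N)..1, betaTerm ((b + 1) * N) (a * N) N u) atTop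
      (nhds (Ferfc (√2 * (√((a + 1 + b) ^ 3 / (2 * (a + 1) * b)) * ξ)))) := by
  have hκ : 0 < (a + 1 + b) ^ 3 / (2 * (a + 1) * b) := by positivity
  have hc : ((a + 1) / (a + 1 + b))⁻¹ ≠ 0 := by positivity
  have h1 := tendsto_sqrt_mul_integral_betaKernel (A := a + 1) (by linarith) hb
    (S := fun N => Set.Ioi (x N)) (T := Set.Ioi ξ) (fun _ => measurableSet_Ioi) measurableSet_Ioi (by
      have hne : ∀ᵐ v : ℝ, v ≠ ξ := by simp [ae_iff]
      filter_upwards [hne] with v hv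
      rcases lt_or_gt_of_ne hv with h | h
      · filter_upwards [hξ.eventually (lt_mem_nhds h), eventually_gt_atTop 0] with N hN hN0
        have hsp : 0 < √(N : ℝ) := Real.sqrt_pos.2 (by exact_mod_cast hN0)
        rw [mul_comm, ← div_lt_iff₀ hsp] at hN
        simp only [Set.mem_Ioi, not_lt.2 h.le, iff_false]
        linarith
      · filter_upwards [hξ.eventually (gt_mem_nhds h), eventually_gt_atTop 0] with N hN hN0
        have hsp : 0 < √(N : ℝ) := Real.sqrt_pos.2 (by exact_mod_cast hN0)
        rw [mul_comm, ← lt_div_iff₀ hsp] at hN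
        simp only [Set.mem_Ioi, h, iff_true]
        linarith)
  have h2 := tendsto_sqrt_mul_integral_betaKernel (A := a + 1) (by linarith) hb
    (S := fun _ => Set.univ) (T := Set.univ) (fun _ => MeasurableSet.univ) MeasurableSet.univ
    (by simp)
  rw [setIntegral_univ] at h2
  have hne : (∫ v : ℝ, ((a + 1) / (a + 1 + b))⁻¹ *
      Real.exp (-((a + 1 + b) ^ 3 / (2 * (a + 1) * b)) * v ^ 2)) ≠ 0 := by
    rw [integral_const_mul, integral_gaussian]
    exact mul_ne_zero hc (Real.sqrt_pos.2 (div_pos Real.pi_pos hκ)).ne'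
  have h := h1.div h2 hne
  rw [gaussian_tail_ratio hκ hc] at h
  have e : Ferfc (√2 * (√((a + 1 + b) ^ 3 / (2 * (a + 1) * b)) * ξ)) = (1 / √Real.pi) *
      ∫ u in Set.Ioi (√((a + 1 + b) ^ 3 / (2 * (a + 1) * b)) * ξ), Real.exp (-u ^ 2) := by
    rw [Ferfc, erfc, mul_div_cancel_left₀ _ (by positivity)]
    ring
  rw [e]
  refine h.congr' ?_
  filter_upwards [hx, eventually_gt_atTop 0] with N hN hN0
  have hsp : 0 < √(N : ℝ) := Real.sqrt_pos.2 (by exact_mod_cast hN0)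
  rw [integral_betaTerm_eq_ratio ha hb hN0 hN]
  exact mul_div_mul_left _ _ (ne_of_gt hsp)

/-- The Gaussian cross-factor coming from the mismatch of the weight and `1 + z w`. -/
lemma tendsto_one_add_rpow_neg_half {m e : ℕ → ℝ} {c : ℝ} (hm : ∀ᶠ N in atTop, 0 ≤ m N)
    (he : ∀ᶠ N in atTop, 0 ≤ e N) (he0 : Tendsto e atTop (nhds 0))
    (hme : Tendsto (fun N => m N * e N) atTop (nhds c)) :
    Tendsto (fun N => (1 + e N) ^ (-m N / 2)) atTop (nhds (Real.exp (-c / 2))) := by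
  have hlog : Tendsto (fun N => m N * Real.log (1 + e N)) atTop (nhds c) := by
    have hlow : Tendsto (fun N => m N * e N * (1 + e N)⁻¹) atTop (nhds c) := by
      simpa using hme.mul ((he0.const_add 1).inv₀ (by norm_num))
    refine tendsto_of_tendsto_of_tendsto_of_le_of_le' hlow hme ?_ ?_
    · filter_upwards [hm, he] with N h1 h2
      rw [mul_assoc]
      refine mul_le_mul_of_nonneg_left ?_ h1
      have := Real.one_sub_inv_le_log_of_pos (x := 1 + e N) (by linarith)
      have h3 : e N * (1 + e N)⁻¹ = 1 - (1 + e N)⁻¹ := by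
        have : 1 + e N ≠ 0 := by linarith
        field_simp
        ring
      rwa [h3]
    · filter_upwards [hm, he] with N h1 h2
      refine mul_le_mul_of_nonneg_left ?_ h1
      linarith [Real.log_le_sub_one_of_pos (x := 1 + e N) (by linarith)]
  refine ((Real.continuous_exp.tendsto _).comp (hlog.neg.div_const 2)).congr' ?_
  filter_upwards [he] with N h2
  rw [Real.rpow_def_of_pos (by linarith)]
  simp only [Function.comp_apply]
  ring_nf

/-- Rewriting the weighted sum in terms of the success probability `x = y / (1 + y)`. -/
lemma qhat_mul_weight_eq {n L y lam z w : ℝ} {N : ℕ} (hN : 0 < N) (hy : 0 < y) (hzw : z * w = y) :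
    qhat n L (N - 1) y lam * y ^ L * ((1 + z ^ 2) * (1 + w ^ 2)) ^ (-(n + L + 1) / 2) =
      (1 + y)⁻¹ * (1 + (z - w) ^ 2 / (1 + y) ^ 2) ^ (-(n + L + 1) / 2) *
        (binomialTail n L N (y / (1 + y)) + (n * lam - L)⁻¹ *
          (Real.Gamma (L + n + 1) / (Real.Gamma (n + 1) * Real.Gamma L) *
            ((y / (1 + y)) ^ L * (1 - y / (1 + y)) ^ n))) := by
  have h1y : 0 < 1 + y := by linarith
  have e1 : 1 - y / (1 + y) = (1 + y)⁻¹ := by field_simp; ring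
  have hterm : ∀ p q : ℝ, p + q = n + L →
      (y / (1 + y)) ^ p * (1 - y / (1 + y)) ^ q = y ^ p * (1 + y) ^ (-(n + L)) := by
    intro p q hpq
    rw [e1, Real.div_rpow hy.le h1y.le, Real.inv_rpow h1y.le, ← Real.rpow_neg h1y.le, div_eq_mul_inv,
      ← Real.rpow_neg h1y.le, mul_assoc, ← Real.rpow_add h1y]
    congr 2
    linarith
  have hsum : binomialTail n L N (y / (1 + y)) =
      qS n L (N - 1) y * y ^ L * (1 + y) ^ (-(n + L)) := by
    rw [binomialTail, qS, Nat.sub_add_cancel hN, Finset.sum_mul, Finset.sum_mul]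
    refine Finset.sum_congr rfl fun k _ => ?_
    rw [hterm _ _ (by ring), Real.rpow_add hy, Real.rpow_natCast]
    ring
  have hW : ((1 + z ^ 2) * (1 + w ^ 2)) ^ (-(n + L + 1) / 2) = (1 + y) ^ (-(n + L)) *
      ((1 + y)⁻¹ * (1 + (z - w) ^ 2 / (1 + y) ^ 2) ^ (-(n + L + 1) / 2)) := by
    have : (1 + z ^ 2) * (1 + w ^ 2) = (1 + y) ^ 2 * (1 + (z - w) ^ 2 / (1 + y) ^ 2) := by
      field_simp
      rw [← hzw]
      ring
    rw [this, Real.mul_rpow (by positivity) (by positivity), ← Real.rpow_natCast,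
      ← Real.rpow_mul h1y.le, ← mul_assoc]
    congr 1
    rw [← Real.rpow_neg_one, ← Real.rpow_add h1y]
    congr 1
    push_cast
    ring
  rw [hsum, hterm _ _ (by ring), hW, qhat]
  ring

/-- Outer-edge scaling limit, in the strongly non-unitary regime, of the weighted
truncated sum `q̂ · ω̂` arising from the induced spherical unitary ensemble. -/
theorem qhat_outer_edge_limit (a b : ℝ) (ha : 0 ≤ a) (hb : 0 < b) (s t χ : ℝ) :
    Tendsto (fun N : ℕ =>
      let p : ℝ := Real.sqrt ((a + 1) / b)
      let LN : ℝ := a * N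
      let nN : ℝ := (b + 1) * N
      let δN : ℝ := (nN + LN + 1) / (N * (1 + p ^ 2) ^ 2)
      let zN : ℝ := p + s / Real.sqrt (N * δN)
      let wN : ℝ := p + t / Real.sqrt (N * δN)
      let lamN : ℝ := p + χ / Real.sqrt (N * δN)
      qhat nN LN (N - 1) (zN * wN) (lamN ^ 2) * (zN * wN) ^ LN *
        ((1 + zN ^ 2) * (1 + wN ^ 2)) ^ (-(nN + LN + 1) / 2))
      atTop
      (nhds (Real.exp (-(s - t) ^ 2 / 2) * Ferfc (s + t) /
        (1 + Real.sqrt ((a + 1) / b) ^ 2))) := by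
  set p : ℝ := √((a + 1) / b) with hp
  have hp2 : p ^ 2 = (a + 1) / b := Real.sq_sqrt (by positivity)
  have hp0 : 0 < p := Real.sqrt_pos.2 (by positivity)
  set m : ℕ → ℝ := fun N => (b + 1) * N + a * N + 1 with hm
  set r : ℕ → ℝ := fun N => √((N : ℝ) * (m N / (N * (1 + p ^ 2) ^ 2))) with hr
  set z : ℕ → ℝ := fun N => p + s / r N with hz
  set w : ℕ → ℝ := fun N => p + t / r N with hw
  set l : ℕ → ℝ := fun N => p + χ / r N with hl
  set y : ℕ → ℝ := fun N => z N * w N with hy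
  set x : ℕ → ℝ := fun N => y N / (1 + y N) with hx
  have hm0 : ∀ N, 0 < m N := fun N => by simp only [hm]; positivity
  have hr2 : ∀ᶠ N : ℕ in atTop, r N ^ 2 = m N / (1 + p ^ 2) ^ 2 := by
    filter_upwards [eventually_gt_atTop 0] with N hN
    have hN' : (0 : ℝ) < N := by exact_mod_cast hN
    have := hm0 N
    simp only [hr]
    rw [Real.sq_sqrt (by positivity)]
    field_simp
  have hr0 : ∀ᶠ N : ℕ in atTop, 0 < r N := by
    filter_upwards [eventually_gt_atTop 0] with N hN
    have hN' : (0 : ℝ) < N := by exact_mod_cast hN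
    have := hm0 N
    exact Real.sqrt_pos.2 (by positivity)
  have hinvN : Tendsto (fun N : ℕ => ((N : ℝ))⁻¹) atTop (nhds 0) :=
    tendsto_inv_atTop_zero.comp tendsto_natCast_atTop_atTop
  have hsq : Tendsto (fun N : ℕ => √(N : ℝ) / r N) atTop
      (nhds ((1 + p ^ 2) / √(a + 1 + b))) := by
    have h1 : Tendsto (fun N : ℕ => √((1 + p ^ 2) ^ 2 / (a + 1 + b + ((N : ℝ))⁻¹))) atTop
        (nhds (√((1 + p ^ 2) ^ 2 / (a + 1 + b + 0)))) :=
      (Real.continuous_sqrt.tendsto _).comp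
        (tendsto_const_nhds.div (hinvN.const_add _) (by positivity))
    rw [add_zero, Real.sqrt_div (by positivity), Real.sqrt_sq (by positivity)] at h1
    refine h1.congr' ?_
    filter_upwards [hr0, hr2, eventually_gt_atTop 0] with N h0 h2 hN
    have hN' : (0 : ℝ) < N := by exact_mod_cast hN
    have := hm0 N
    rw [← Real.sqrt_sq h0.le, ← Real.sqrt_div hN'.le, h2]
    congr 1
    simp only [hm]
    field_simp
    ring
  have hrinv : Tendsto (fun N => (r N)⁻¹) atTop (nhds 0) := by
    have hs : Tendsto (fun N : ℕ => (√(N : ℝ))⁻¹) atTop (nhds 0) :=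
      tendsto_inv_atTop_zero.comp (Real.tendsto_sqrt_atTop.comp tendsto_natCast_atTop_atTop)
    have := hsq.mul hs
    rw [mul_zero] at this
    refine this.congr' ?_
    filter_upwards [hr0, eventually_gt_atTop 0] with N h0 hN
    have hsp : 0 < √(N : ℝ) := Real.sqrt_pos.2 (by exact_mod_cast hN)
    field_simp
  have hshift : ∀ c : ℝ, Tendsto (fun N => p + c / r N) atTop (nhds p) := fun c => by
    simpa [div_eq_mul_inv] using (hrinv.const_mul c).const_add p
  have hyl : Tendsto y atTop (nhds (p ^ 2)) := by
    rw [sq]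
    exact (hshift s).mul (hshift t)
  have hy0 : ∀ᶠ N in atTop, 0 < y N := hyl.eventually (lt_mem_nhds (by positivity))
  have hu0 : p ^ 2 / (1 + p ^ 2) = (a + 1) / (a + 1 + b) := by
    rw [hp2]
    field_simp
    ring
  have hxl : Tendsto x atTop (nhds ((a + 1) / (a + 1 + b))) := by
    rw [← hu0]
    exact hyl.div (hyl.const_add 1) (by positivity)
  obtain ⟨v, hv, hvx⟩ := exists_between
    (show a / (a + (b + 1)) < (a + 1) / (a + 1 + b) by
      rw [show a + (b + 1) = a + 1 + b by ring]
      gcongr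
      linarith)
  have hv0 : 0 < v := lt_of_le_of_lt (by positivity) hv
  have hxv : ∀ᶠ N in atTop, x N ∈ Set.Ioo v 1 :=
    hxl.eventually (Ioo_mem_nhds hvx (by rw [div_lt_one (by positivity)]; linarith))
  have hx01 : ∀ᶠ N in atTop, x N ∈ Set.Ioo (0 : ℝ) 1 :=
    hxv.mono fun N h => ⟨hv0.trans h.1, h.2⟩
  have hξ : Tendsto (fun N : ℕ => √(N : ℝ) * (x N - (a + 1) / (a + 1 + b))) atTop
      (nhds (p * (s + t) / ((1 + p ^ 2) * √(a + 1 + b)))) := by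
    have h1 := (hsq.mul ((hrinv.const_mul (s * t)).const_add (p * (s + t)))).div
      ((hyl.const_add 1).mul_const (1 + p ^ 2)) (by positivity)
    have e : (1 + p ^ 2) / √(a + 1 + b) * (p * (s + t) + s * t * 0) / ((1 + p ^ 2) * (1 + p ^ 2)) =
        p * (s + t) / ((1 + p ^ 2) * √(a + 1 + b)) := by
      have : 0 < √(a + 1 + b) := Real.sqrt_pos.2 (by positivity)
      field_simp
      ring
    rw [e] at h1
    refine h1.congr' ?_
    filter_upwards [hr0, hy0] with N h0 hy0
    have e2 : x N - (a + 1) / (a + 1 + b) = (y N - p ^ 2) / ((1 + y N) * (1 + p ^ 2)) := by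
      rw [← hu0]
      simp only [hx]
      have : 0 < 1 + y N := by linarith
      field_simp
      ring
    have e3 : y N - p ^ 2 = (p * (s + t) + s * t * (r N)⁻¹) / r N := by
      simp only [hy, hz, hw]
      field_simp
      ring
    rw [e2, e3]
    simp only [Pi.div_apply]
    ring
  have hconst : √2 * (√((a + 1 + b) ^ 3 / (2 * (a + 1) * b)) *
      (p * (s + t) / ((1 + p ^ 2) * √(a + 1 + b)))) = s + t := by
    have hk : √2 * √((a + 1 + b) ^ 3 / (2 * (a + 1) * b)) * p / ((1 + p ^ 2) * √(a + 1 + b)) = 1 := by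
      rw [div_eq_one_iff_eq (by positivity)]
      refine (sq_eq_sq₀ (by positivity) (by positivity)).1 ?_
      simp only [mul_pow]
      rw [hp2, Real.sq_sqrt (by positivity), Real.sq_sqrt (by positivity),
        Real.sq_sqrt (by positivity)]
      field_simp
      ring
    linear_combination (s + t) * hk
  have htail : Tendsto (fun N : ℕ => binomialTail ((b + 1) * N) (a * N) N (x N)) atTop
      (nhds (Ferfc (s + t))) := by
    have h1 := (tendsto_integral_betaTerm ha hb hx01 hξ).sub
      (tendsto_integral_betaTerm_zero ha (by linarith) hv hxv)
    rw [hconst, sub_zero] at h1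
    refine h1.congr' ?_
    filter_upwards [hx01] with N h
    rw [binomialTail_eq_integral (by positivity) _ h]
    nlinarith [(Nat.cast_nonneg N : (0 : ℝ) ≤ N)]
  have hG := tendsto_gamma_ratio_mul_rpow ha (show 0 < b + 1 by linarith) hv hxv
  have hinv : Tendsto (fun N : ℕ => ((b + 1) * N * l N ^ 2 - a * N)⁻¹) atTop (nhds 0) := by
    have hc : Tendsto (fun N : ℕ => (b + 1) * l N ^ 2 - a) atTop (nhds ((b + 1) * p ^ 2 - a)) :=
      (((hshift χ).pow 2).const_mul _).sub_const _
    have hne : (b + 1) * p ^ 2 - a ≠ 0 := by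
      have : (b + 1) * p ^ 2 - a = 1 + p ^ 2 := by rw [hp2]; field_simp; ring
      rw [this]
      positivity
    have := hinvN.mul (hc.inv₀ hne)
    rw [zero_mul] at this
    refine this.congr fun N => ?_
    rw [← mul_inv]
    ring_nf
  have hR : Tendsto (fun N => (1 + y N)⁻¹ * (1 + (z N - w N) ^ 2 / (1 + y N) ^ 2) ^ (-m N / 2))
      atTop (nhds ((1 + p ^ 2)⁻¹ * Real.exp (-(s - t) ^ 2 / 2))) := by
    have hyi : Tendsto (fun N => (1 + y N)⁻¹) atTop (nhds ((1 + p ^ 2)⁻¹)) :=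
      (hyl.const_add 1).inv₀ (by positivity)
    refine hyi.mul (tendsto_one_add_rpow_neg_half (Eventually.of_forall fun N => (hm0 N).le)
      (Eventually.of_forall fun N => by positivity) ?_ ?_)
    · have := (((hshift s).sub (hshift t)).pow 2).mul (hyi.pow 2)
      rw [sub_self, zero_pow two_ne_zero, zero_mul] at this
      refine this.congr fun N => ?_
      rw [inv_pow, ← div_eq_mul_inv]
    · have := ((hyi.pow 2).const_mul ((s - t) ^ 2 * (1 + p ^ 2) ^ 2))
      have e : (s - t) ^ 2 * (1 + p ^ 2) ^ 2 * (1 + p ^ 2)⁻¹ ^ 2 = (s - t) ^ 2 := by field_simp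
      rw [e] at this
      refine this.congr' ?_
      filter_upwards [hr0, hr2] with N h0 h2
      have e1 : z N - w N = (s - t) / r N := by
        simp only [hz, hw]
        ring
      have hmN := hm0 N
      rw [e1, div_pow, h2]
      field_simp
  have hfin := hR.mul (htail.add (hinv.mul hG))
  have e : (1 + p ^ 2)⁻¹ * Real.exp (-(s - t) ^ 2 / 2) * (Ferfc (s + t) + 0 * 0) =
      Real.exp (-(s - t) ^ 2 / 2) * Ferfc (s + t) / (1 + p ^ 2) := by ring
  rw [e] at hfin
  refine hfin.congr' ?_
  filter_upwards [hy0, eventually_gt_atTop 0] with N h0 hN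
  exact (qhat_mul_weight_eq (n := (b + 1) * N) (L := a * N) (lam := l N ^ 2) hN h0 rfl).symm
end
end

section
/- Let a > 0 and b > 0 be real numbers, and set p = √(a/(b+1)). For each positive integer N set L_N = a·N, n_N = (b+1)·N, δ_N = (n_N + L_N + 1)/(N·(1+p²)²). Fix real numbers s, t, χ with χ ≠ 0 and set z_N = p − s/√(N·δ_N), w_N = p − t/√(N·δ_N), λ_N = p − χ/√(N·δ_N). Then lim_{N→∞} q̂_{N−1}^{(n_N,L_N)}(z_N·w_N | λ_N²) · (z_N·w_N)^{L_N} · ((1+z_N²)(1+w_N²))^{−(n_N+L_N+1)/2} = (e^{−(s−t)²/2}/(1+p²)) · ( F(s+t) − (1/(2χ))·e^{−(s+t)²/2}/√(2π) ), where F(x) = (1/2)·erfc(x/√2) with erfc(x) = (2/√π)·∫_x^∞ e^{−u²} du, and all powers with real exponents are real powers. -/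
open Finset Filter MeasureTheory

noncomputable section

open ProbabilityTheory Set

theorem log_one_add_le_sub_sq {u : ℝ} (h : -1 < u) (h0 : u ≤ 0) :
    Real.log (1 + u) ≤ u - u ^ 2 / 2 := by
  have hs := Real.hasSum_pow_div_log_of_abs_lt_one (x := -u)
    (by rw [abs_lt]; constructor <;> linarith)
  have := hs.summable.sum_le_tsum (Finset.range 2) (fun i _ => by
    have : 0 ≤ -u := by linarith
    positivity)
  rw [hs.tsum_eq] at this
  norm_num [Finset.sum_range_succ] at this
  linarith

theorem tendsto_mul_log_one_add_sub {k u : ℕ → ℝ} {q : ℝ} (hu : Tendsto u atTop (nhds 0))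
    (hk : Tendsto (fun N => k N * u N ^ 2) atTop (nhds q)) :
    Tendsto (fun N => k N * (Real.log (1 + u N) - u N)) atTop (nhds (-q / 2)) := by
  have hb : ∀ᶠ N in atTop, |k N * (Real.log (1 + u N) - u N) - (-(k N * u N ^ 2) / 2)| ≤
      |k N * u N ^ 2| * (2 * |u N|) := by
    filter_upwards [hu.eventually (Metric.ball_mem_nhds (0 : ℝ) (by norm_num : (0 : ℝ) < 1 / 2))]
      with N hN
    have hN' : |u N| < 1 / 2 := by simpa using hN
    have h := Real.abs_log_sub_add_sum_range_le (x := -u N) (by rw [abs_neg]; linarith) 2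
    norm_num [Finset.sum_range_succ] at h
    have e : k N * (Real.log (1 + u N) - u N) - (-(k N * u N ^ 2) / 2) =
        k N * (-u N + u N ^ 2 / 2 + Real.log (1 + u N)) := by ring
    rw [e, abs_mul, abs_mul, mul_assoc]
    gcongr
    refine h.trans ?_
    rw [div_le_iff₀ (by linarith), abs_pow]
    have := abs_nonneg (u N)
    nlinarith [mul_nonneg (pow_nonneg this 3) (sub_nonneg.2 hN'.le)]
  have h0 : Tendsto (fun N => |k N * u N ^ 2| * (2 * |u N|)) atTop (nhds 0) := by
    simpa using hk.abs.mul (hu.abs.const_mul 2)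
  have h1 := squeeze_zero_norm' (hb.mono fun N hN => (Real.norm_eq_abs _).trans_le hN) h0
  have h2 : Tendsto (fun N => -(k N * u N ^ 2) / 2) atTop (nhds (-q / 2)) := hk.neg.div_const 2
  simpa using h1.add h2

theorem integrable_betaPDFReal {p q : ℝ} (hp : 0 < p) (hq : 0 < q) :
    Integrable (betaPDFReal p q) := by
  refine ⟨(measurable_betaPDFReal p q).aestronglyMeasurable, ?_⟩
  rw [hasFiniteIntegral_iff_ofReal]
  · exact (lintegral_betaPDF_eq_one hp hq).trans_lt ENNReal.one_lt_top
  · refine Eventually.of_forall fun x => ?_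
    by_cases h : 0 < x ∧ x < 1
    · exact (betaPDFReal_pos h.1 h.2 hp hq).le
    · simp [betaPDFReal, h]

theorem integral_betaPDFReal {p q : ℝ} (hp : 0 < p) (hq : 0 < q) :
    ∫ x, betaPDFReal p q x = 1 := by
  rw [integral_eq_lintegral_of_nonneg_ae _ (measurable_betaPDFReal p q).aestronglyMeasurable]
  · exact (congrArg ENNReal.toReal (lintegral_betaPDF_eq_one hp hq)).trans ENNReal.toReal_one
  · refine Eventually.of_forall fun x => ?_
    by_cases h : 0 < x ∧ x < 1
    · exact (betaPDFReal_pos h.1 h.2 hp hq).le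
    · simp [betaPDFReal, h]

/-- The cumulative distribution function of the beta distribution. -/
def betaCDFReal (p q x : ℝ) : ℝ := ∫ u in Set.Iic x, betaPDFReal p q u

theorem betaCDFReal_eq_intervalIntegral (p q : ℝ) {x : ℝ} (hx : 0 ≤ x) :
    betaCDFReal p q x = ∫ u in (0 : ℝ)..x, betaPDFReal p q u := by
  rw [intervalIntegral.integral_of_le hx, betaCDFReal]
  refine setIntegral_eq_of_subset_of_forall_sdiff_eq_zero measurableSet_Iic
    (fun u hu => hu.2) fun u hu => ?_
  have : ¬ 0 < u := fun h => hu.2 ⟨h, hu.1⟩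
  simp [betaPDFReal, this]

theorem betaPDFReal_sub_succ {p q u : ℝ} (hp : 0 < p) (hq : 0 < q) (hu : u ∈ Set.Ioo (0 : ℝ) 1) :
    betaPDFReal p (q + 1) u - betaPDFReal (p + 1) q u =
      Real.Gamma (p + q + 1) / (Real.Gamma (p + 1) * Real.Gamma (q + 1)) *
        (p * u ^ (p - 1) * (1 - u) ^ q - u ^ p * (q * (1 - u) ^ (q - 1))) := by
  have h1 := Real.Gamma_pos_of_pos hp
  have h2 := Real.Gamma_pos_of_pos hq
  have h3 := Real.Gamma_pos_of_pos (show 0 < p + q + 1 by linarith)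
  rw [betaPDFReal, betaPDFReal, if_pos ⟨hu.1, hu.2⟩, if_pos ⟨hu.1, hu.2⟩, beta, beta,
    Real.Gamma_add_one hp.ne',
    Real.Gamma_add_one hq.ne', add_sub_cancel_right, add_sub_cancel_right, ← add_assoc,
    show p + 1 + q = p + q + 1 by ring]
  field_simp

theorem betaCDFReal_sub_succ {p q x : ℝ} (hp : 0 < p) (hq : 0 < q) (hx : x ∈ Set.Ioo (0 : ℝ) 1) :
    betaCDFReal p (q + 1) x - betaCDFReal (p + 1) q x =
      Real.Gamma (p + q + 1) / (Real.Gamma (p + 1) * Real.Gamma (q + 1)) *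
        (x ^ p * (1 - x) ^ q) := by
  have i1 := (integrable_betaPDFReal hp (show 0 < q + 1 by linarith)).intervalIntegrable
    (a := 0) (b := x)
  have i2 := (integrable_betaPDFReal (show 0 < p + 1 by linarith) hq).intervalIntegrable
    (a := 0) (b := x)
  rw [betaCDFReal_eq_intervalIntegral _ _ hx.1.le, betaCDFReal_eq_intervalIntegral _ _ hx.1.le,
    ← intervalIntegral.integral_sub i1 i2,
    intervalIntegral.integral_eq_sub_of_hasDerivAt_of_le (f := fun u =>
      Real.Gamma (p + q + 1) / (Real.Gamma (p + 1) * Real.Gamma (q + 1)) *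
        (u ^ p * (1 - u) ^ q)) hx.1.le ?_ ?_ (i1.sub i2)]
  · simp [Real.zero_rpow hp.ne']
  · refine Continuous.continuousOn ?_
    have h1 : Continuous fun u : ℝ => u ^ p := Real.continuous_rpow_const hp.le
    have h2 : Continuous fun u : ℝ => (1 - u) ^ q :=
      (Real.continuous_rpow_const hq.le).comp (by fun_prop)
    fun_prop
  · intro u hu
    have hu' : u ∈ Set.Ioo (0 : ℝ) 1 := ⟨hu.1, hu.2.trans hx.2⟩
    rw [betaPDFReal_sub_succ hp hq hu']
    refine HasDerivAt.const_mul _ ?_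
    have h1 := Real.hasDerivAt_rpow_const (p := p) (Or.inl hu'.1.ne')
    have h2 := ((hasDerivAt_id u).const_sub 1).rpow_const (p := q)
      (Or.inl (sub_pos.2 hu'.2).ne')
    convert! h1.mul h2 using 1
    simp; ring

/-- The density of the beta distribution with parameters `α N` and `β N + 1`, centred at the mode
`α / (α + β)`, rescaled to asymptotically unit variance and normalised to the value `1` at the centre. -/
def rescaledBeta (α β : ℝ) (N : ℕ) (v : ℝ) : ℝ :=
  if -1 < √(β / (α * (α + β))) * v / √N ∧ √(α / (β * (α + β))) * v / √N < 1 then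
    (1 + √(β / (α * (α + β))) * v / √N) ^ (α * N - 1) *
      (1 - √(α / (β * (α + β))) * v / √N) ^ (β * N)
  else 0

theorem mul_sqrt_div_eq {α β : ℝ} (hα : 0 < α) (hβ : 0 < β) :
    α * √(β / (α * (α + β))) = β * √(α / (β * (α + β))) := by
  rw [← Real.sqrt_sq hα.le, ← Real.sqrt_sq hβ.le, ← Real.sqrt_mul (by positivity),
    ← Real.sqrt_mul (by positivity), Real.sqrt_sq hα.le, Real.sqrt_sq hβ.le]
  congr 1
  field_simp

theorem measurable_rescaledBeta (α β : ℝ) (N : ℕ) : Measurable (rescaledBeta α β N) := by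
  refine Measurable.ite ?_ (by fun_prop) measurable_const
  exact (measurableSet_lt (f := fun _ => (-1 : ℝ))
      (g := fun v : ℝ => √(β / (α * (α + β))) * v / √N) (by fun_prop) (by fun_prop)).inter
    (measurableSet_lt (f := fun v : ℝ => √(α / (β * (α + β))) * v / √N)
      (g := fun _ => (1 : ℝ)) (by fun_prop) (by fun_prop))

theorem rescaledBeta_nonneg (α β : ℝ) (N : ℕ) (v : ℝ) : 0 ≤ rescaledBeta α β N v := by
  unfold rescaledBeta
  split_ifs with h
  · exact mul_nonneg (Real.rpow_nonneg (by linarith [h.1]) _)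
      (Real.rpow_nonneg (by linarith [h.2]) _)
  · exact le_rfl

theorem rescaledBeta_eq_exp {α β : ℝ} {N : ℕ} {v : ℝ}
    (h : -1 < √(β / (α * (α + β))) * v / √N ∧ √(α / (β * (α + β))) * v / √N < 1) :
    rescaledBeta α β N v = Real.exp
      ((α * N - 1) * Real.log (1 + √(β / (α * (α + β))) * v / √N) +
        β * N * Real.log (1 - √(α / (β * (α + β))) * v / √N)) := by
  rw [rescaledBeta, if_pos h, Real.exp_add, Real.rpow_def_of_pos (by linarith [h.1]),
    Real.rpow_def_of_pos (by linarith [h.2])]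
  simp only [mul_comm]

theorem tendsto_rescaledBeta {α β : ℝ} (hα : 0 < α) (hβ : 0 < β) {v : ℕ → ℝ} {c : ℝ}
    (hv : Tendsto v atTop (nhds c)) :
    Tendsto (fun N => rescaledBeta α β N (v N)) atTop (nhds (Real.exp (-c ^ 2 / 2))) := by
  have hAB := mul_sqrt_div_eq hα hβ
  have hA2 : √(β / (α * (α + β))) ^ 2 = β / (α * (α + β)) := Real.sq_sqrt (by positivity)
  have hB2 : √(α / (β * (α + β))) ^ 2 = α / (β * (α + β)) := Real.sq_sqrt (by positivity)
  have key := @rescaledBeta_eq_exp α β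
  set A := √(β / (α * (α + β)))
  set B := √(α / (β * (α + β)))
  have hN : Tendsto (fun N : ℕ => √(N : ℝ)) atTop atTop :=
    Real.tendsto_sqrt_atTop.comp tendsto_natCast_atTop_atTop
  have hu (C : ℝ) : Tendsto (fun N : ℕ => C * v N / √N) atTop (nhds 0) :=
    (hv.const_mul C).div_atTop hN
  have hk (γ C : ℝ) : Tendsto (fun N : ℕ => γ * N * (C * v N / √N) ^ 2) atTop
      (nhds (γ * C ^ 2 * c ^ 2)) := by
    refine ((hv.pow 2).const_mul (γ * C ^ 2)).congr' ?_
    filter_upwards [eventually_gt_atTop 0] with N hN0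
    have : (0 : ℝ) < N := by exact_mod_cast hN0
    rw [div_pow, Real.sq_sqrt this.le]
    field_simp
  have h1 := tendsto_mul_log_one_add_sub (hu A) (hk α A)
  have h2 := tendsto_mul_log_one_add_sub (hu (-B)) (hk β (-B))
  have h3 : Tendsto (fun N : ℕ => Real.log (1 + A * v N / √N)) atTop (nhds 0) := by
    have := ((hu A).const_add 1).log (by norm_num)
    simpa using this
  have h4 := (((h1.add h2).sub h3)).rexp
  have e : -(α * A ^ 2 * c ^ 2) / 2 + -(β * (-B) ^ 2 * c ^ 2) / 2 - 0 = -c ^ 2 / 2 := by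
    rw [neg_sq, hA2, hB2]
    field_simp
    ring
  rw [e] at h4
  refine h4.congr' ?_
  filter_upwards [(hu A).eventually_const_lt (show (-1 : ℝ) < 0 by norm_num),
    (hu B).eventually_lt_const (show (0 : ℝ) < 1 by norm_num)] with N hN1 hN2
  rw [key ⟨hN1, hN2⟩]
  congr 1
  have : α * N * (A * v N / √N) = β * N * (B * v N / √N) := by
    linear_combination N * v N / √N * hAB
  rw [show 1 + -B * v N / √N = 1 - B * v N / √N by ring]
  linear_combination -this

theorem rescaledBeta_le {α β : ℝ} (hα : 0 < α) (hβ : 0 < β) {N : ℕ} (hN : 2 ≤ α * N) (v : ℝ) :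
    rescaledBeta α β N v ≤
      Real.exp 1 * Real.exp (-(min (β / (4 * (α + β))) (α / (4 * (α + β)))) * v ^ 2) := by
  have hAB := mul_sqrt_div_eq hα hβ
  have hA2 : √(β / (α * (α + β))) ^ 2 = β / (α * (α + β)) := Real.sq_sqrt (by positivity)
  have hB2 : √(α / (β * (α + β))) ^ 2 = α / (β * (α + β)) := Real.sq_sqrt (by positivity)
  by_cases h : -1 < √(β / (α * (α + β))) * v / √N ∧ √(α / (β * (α + β))) * v / √N < 1
  swap
  · rw [rescaledBeta, if_neg h]
    positivity
  rw [rescaledBeta_eq_exp h, ← Real.exp_add, Real.exp_le_exp]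
  have hA0 : 0 ≤ √(β / (α * (α + β))) := Real.sqrt_nonneg _
  have hB0 : 0 ≤ √(α / (β * (α + β))) := Real.sqrt_nonneg _
  set A := √(β / (α * (α + β)))
  set B := √(α / (β * (α + β)))
  obtain ⟨hu, hw⟩ := h
  have hN0 : (0 : ℝ) < N := by
    by_contra! hc
    nlinarith
  have heq : α * N * (A * v / √N) = β * N * (B * v / √N) := by
    linear_combination N * v / √N * hAB
  have hu2 : α * N * (A * v / √N) ^ 2 = β / (α + β) * v ^ 2 := by
    rw [div_pow, mul_pow, hA2, Real.sq_sqrt hN0.le]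
    field_simp
  have hw2 : β * N * (B * v / √N) ^ 2 = α / (α + β) * v ^ 2 := by
    rw [div_pow, mul_pow, hB2, Real.sq_sqrt hN0.le]
    field_simp
  have hβN : 0 ≤ β * N := by positivity
  have hs := Real.sqrt_nonneg (N : ℝ)
  have hm1 : min (β / (4 * (α + β))) (α / (4 * (α + β))) * v ^ 2 ≤ β / (α + β) * v ^ 2 / 4 := by
    calc _ ≤ β / (4 * (α + β)) * v ^ 2 := by gcongr; exact min_le_left _ _
      _ = _ := by field_simp
  have hm2 : min (β / (4 * (α + β))) (α / (4 * (α + β))) * v ^ 2 ≤ α / (α + β) * v ^ 2 / 4 := by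
    calc _ ≤ α / (4 * (α + β)) * v ^ 2 := by gcongr; exact min_le_right _ _
      _ = _ := by field_simp
  have hp : 0 ≤ α / (α + β) * v ^ 2 := by positivity
  rcases le_total 0 v with hv | hv
  · have hu0 : 0 ≤ A * v / √N := by positivity
    have hw0 : 0 ≤ B * v / √N := by positivity
    have l1 := Real.log_le_sub_one_of_pos (show 0 < 1 + A * v / √N by linarith)
    have l2 := log_one_add_le_sub_sq (u := -(B * v / √N)) (by linarith) (by linarith)
    rw [← sub_eq_add_neg] at l2
    have m1 := mul_le_mul_of_nonneg_left l1 (show 0 ≤ α * N - 1 by linarith)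
    have m2 := mul_le_mul_of_nonneg_left l2 hβN
    rw [add_sub_cancel_left] at m1
    have e2 : β * N * (-(B * v / √N) - (-(B * v / √N)) ^ 2 / 2) =
        -(β * N * (B * v / √N)) - (β * N * (B * v / √N) ^ 2) / 2 := by ring
    rw [e2, hw2] at m2
    linarith
  · have hu0 : A * v / √N ≤ 0 := div_nonpos_of_nonpos_of_nonneg
      (mul_nonpos_of_nonneg_of_nonpos hA0 hv) hs
    have hw0 : B * v / √N ≤ 0 := div_nonpos_of_nonpos_of_nonneg
      (mul_nonpos_of_nonneg_of_nonpos hB0 hv) hs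
    have l1 := log_one_add_le_sub_sq hu hu0
    have l2 := Real.log_le_sub_one_of_pos (show 0 < 1 - B * v / √N by linarith)
    have m1 := mul_le_mul_of_nonneg_left l1 (show 0 ≤ α * N - 1 by linarith)
    have m2 := mul_le_mul_of_nonneg_left l2 hβN
    have m3 : (α * N - 1) * (A * v / √N - (A * v / √N) ^ 2 / 2) ≤
        α * N * (A * v / √N) + 1 - α * N * (A * v / √N) ^ 2 / 4 := by
      nlinarith [mul_nonneg (sub_nonneg.2 hN) (sq_nonneg (A * v / √N))]
    rw [hu2] at m3
    linarith

theorem tendsto_setIntegral_rescaledBeta {α β : ℝ} (hα : 0 < α) (hβ : 0 < β) {S : ℕ → Set ℝ}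
    {T : Set ℝ} (hS : ∀ N, MeasurableSet (S N)) (hT : MeasurableSet T)
    (h : ∀ᵐ v : ℝ, ∀ᶠ N in atTop, (v ∈ S N ↔ v ∈ T)) :
    Tendsto (fun N => ∫ v in S N, rescaledBeta α β N v) atTop
      (nhds (∫ v in T, Real.exp (-v ^ 2 / 2))) := by
  simp_rw [← integral_indicator (hS _), ← integral_indicator hT]
  have hmin : 0 < min (β / (4 * (α + β))) (α / (4 * (α + β))) := lt_min (by positivity) (by positivity)
  refine tendsto_integral_filter_of_dominated_convergence _
    (Eventually.of_forall fun N =>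
      ((measurable_rescaledBeta α β N).indicator (hS N)).aestronglyMeasurable) ?_
    ((integrable_exp_neg_mul_sq hmin).const_mul (Real.exp 1)) ?_
  · filter_upwards [(tendsto_natCast_atTop_atTop.const_mul_atTop hα).eventually_ge_atTop 2]
      with N hN
    refine Eventually.of_forall fun v => (norm_indicator_le_norm_self _ _).trans ?_
    rw [Real.norm_of_nonneg (rescaledBeta_nonneg _ _ _ _)]
    exact rescaledBeta_le hα hβ hN v
  · filter_upwards [h] with v hv
    have h0 := tendsto_rescaledBeta hα hβ (tendsto_const_nhds (x := v))
    by_cases hvT : v ∈ T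
    · rw [indicator_of_mem hvT]
      refine h0.congr' ?_
      filter_upwards [hv] with N hN
      rw [indicator_of_mem (hN.2 hvT)]
    · rw [indicator_of_notMem hvT]
      refine tendsto_const_nhds.congr' ?_
      filter_upwards [hv] with N hN
      rw [indicator_of_notMem (mt hN.1 hvT)]

/-- The scale on which the beta distribution with parameters `α N` and `β N + 1` concentrates. -/
def betaScale (α β : ℝ) (N : ℕ) : ℝ := √(β / (α * (α + β))) * (α / (α + β)) / √N

/-- The height of the density of the beta distribution with parameters `α N` and `β N + 1` at
`α / (α + β)`. -/
def betaHeight (α β : ℝ) (N : ℕ) : ℝ :=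
  1 / beta (α * N) (β * N + 1) * (α / (α + β)) ^ (α * N - 1) * (β / (α + β)) ^ (β * N)

theorem betaScale_pos {α β : ℝ} (hα : 0 < α) (hβ : 0 < β) {N : ℕ} (hN : 0 < N) :
    0 < betaScale α β N := by
  have : (0 : ℝ) < N := by exact_mod_cast hN
  unfold betaScale
  positivity

theorem betaPDFReal_add_scale {α β : ℝ} (hα : 0 < α) (hβ : 0 < β) (N : ℕ) (v : ℝ) :
    betaPDFReal (α * N) (β * N + 1) (α / (α + β) + betaScale α β N * v) =
      betaHeight α β N * rescaledBeta α β N v := by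
  have hAB := mul_sqrt_div_eq hα hβ
  have e1 : α / (α + β) + betaScale α β N * v =
      α / (α + β) * (1 + √(β / (α * (α + β))) * v / √N) := by
    unfold betaScale; ring
  have e2 : 1 - (α / (α + β) + betaScale α β N * v) =
      β / (α + β) * (1 - √(α / (β * (α + β))) * v / √N) := by
    have : betaScale α β N * v = β / (α + β) * (√(α / (β * (α + β))) * v / √N) := by
      unfold betaScale
      linear_combination (v / √N / (α + β)) * hAB
    rw [this]
    field_simp
    ring
  have hm : 0 < α / (α + β) := by positivity
  have hm' : 0 < β / (α + β) := by positivity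
  have hiff : (0 < α / (α + β) + betaScale α β N * v ∧ α / (α + β) + betaScale α β N * v < 1) ↔
      (-1 < √(β / (α * (α + β))) * v / √N ∧ √(α / (β * (α + β))) * v / √N < 1) := by
    rw [← sub_pos (a := (1 : ℝ)), e2, e1, mul_pos_iff_of_pos_left hm, mul_pos_iff_of_pos_left hm',
      sub_pos, neg_lt_iff_pos_add']
  unfold betaPDFReal rescaledBeta betaHeight
  by_cases h : -1 < √(β / (α * (α + β))) * v / √N ∧ √(α / (β * (α + β))) * v / √N < 1
  · rw [if_pos (hiff.2 h), if_pos h, e2, e1, Real.mul_rpow hm.le (by linarith [h.1]),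
      Real.mul_rpow hm'.le (by linarith [h.2]), add_sub_cancel_right]
    ring
  · rw [if_neg (mt hiff.1 h), if_neg h, mul_zero]

theorem integral_comp_add_mul (f : ℝ → ℝ) (m : ℝ) {r : ℝ} (hr : 0 < r) :
    ∫ x, f x = r * ∫ v, f (m + r * v) := by
  rw [Measure.integral_comp_mul_left (fun y => f (m + y)) r, integral_add_left_eq_self f m,
    abs_of_pos (inv_pos.2 hr), smul_eq_mul, mul_inv_cancel_left₀ hr.ne']

theorem betaCDFReal_eq_rescaledBeta {α β : ℝ} (hα : 0 < α) (hβ : 0 < β) {N : ℕ} (hN : 0 < N)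
    (x : ℝ) :
    betaCDFReal (α * N) (β * N + 1) x = betaScale α β N * betaHeight α β N *
      ∫ v in Set.Iic ((x - α / (α + β)) / betaScale α β N), rescaledBeta α β N v := by
  have hr := betaScale_pos hα hβ hN
  rw [betaCDFReal, ← integral_indicator measurableSet_Iic,
    integral_comp_add_mul _ (α / (α + β)) hr, mul_assoc,
    ← integral_const_mul (betaHeight α β N), ← integral_indicator measurableSet_Iic]
  congr 1
  refine integral_congr_ae (Eventually.of_forall fun v => ?_)
  beta_reduce
  have : α / (α + β) + betaScale α β N * v ∈ Set.Iic x ↔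
      v ∈ Set.Iic ((x - α / (α + β)) / betaScale α β N) := by
    rw [Set.mem_Iic, Set.mem_Iic, le_div_iff₀ hr, mul_comm v, le_sub_iff_add_le']
  by_cases hv : v ∈ Set.Iic ((x - α / (α + β)) / betaScale α β N)
  · rw [indicator_of_mem hv, indicator_of_mem (this.2 hv), betaPDFReal_add_scale hα hβ]
  · rw [indicator_of_notMem hv, indicator_of_notMem (mt this.1 hv)]

theorem integral_exp_neg_sq_div_two : ∫ v : ℝ, Real.exp (-v ^ 2 / 2) = √(2 * Real.pi) := by
  have := integral_gaussian (1 / 2)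
  rw [show √(Real.pi / (1 / 2)) = √(2 * Real.pi) by congr 1; ring] at this
  rw [← this]
  congr 1
  ext v
  congr 1
  ring

theorem tendsto_betaScale_mul_betaHeight {α β : ℝ} (hα : 0 < α) (hβ : 0 < β) :
    Tendsto (fun N => betaScale α β N * betaHeight α β N) atTop (nhds (1 / √(2 * Real.pi))) := by
  have h := tendsto_setIntegral_rescaledBeta hα hβ (S := fun _ => Set.univ) (T := Set.univ)
    (fun _ => MeasurableSet.univ) MeasurableSet.univ (by simp)
  simp only [Measure.restrict_univ] at h
  rw [integral_exp_neg_sq_div_two] at h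
  have h' := (tendsto_const_nhds (x := (1 : ℝ))).div h (by positivity)
  refine h'.congr' ?_
  filter_upwards [eventually_gt_atTop 0] with N hN
  have hN' : (0 : ℝ) < N := by exact_mod_cast hN
  have h1 := integral_betaPDFReal (show 0 < α * N by positivity) (show 0 < β * N + 1 by positivity)
  rw [integral_comp_add_mul _ (α / (α + β)) (betaScale_pos hα hβ hN)] at h1
  simp_rw [betaPDFReal_add_scale hα hβ] at h1
  rw [integral_const_mul, ← mul_assoc] at h1
  rw [Pi.div_apply, div_eq_iff (right_ne_zero_of_mul_eq_one h1), h1]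

/-- Local central limit theorem for the beta distribution. -/
theorem tendsto_betaScale_mul_betaPDFReal {α β : ℝ} (hα : 0 < α) (hβ : 0 < β) {x : ℕ → ℝ} {c : ℝ}
    (hx : Tendsto (fun N => (x N - α / (α + β)) / betaScale α β N) atTop (nhds c)) :
    Tendsto (fun N : ℕ => betaScale α β N * betaPDFReal (α * N) (β * N + 1) (x N)) atTop
      (nhds (1 / √(2 * Real.pi) * Real.exp (-c ^ 2 / 2))) := by
  refine ((tendsto_betaScale_mul_betaHeight hα hβ).mul (tendsto_rescaledBeta hα hβ hx)).congr' ?_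
  filter_upwards [eventually_gt_atTop 0] with N hN
  rw [mul_assoc, ← betaPDFReal_add_scale hα hβ, mul_div_cancel₀ _ (betaScale_pos hα hβ hN).ne',
    add_sub_cancel]

theorem tendsto_betaCDFReal_of_eventually {α β : ℝ} (hα : 0 < α) (hβ : 0 < β) {x : ℕ → ℝ}
    {T : Set ℝ} (hT : MeasurableSet T)
    (hx : ∀ᵐ v : ℝ, ∀ᶠ N in atTop, (v ≤ (x N - α / (α + β)) / betaScale α β N ↔ v ∈ T)) :
    Tendsto (fun N : ℕ => betaCDFReal (α * N) (β * N + 1) (x N)) atTop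
      (nhds (1 / √(2 * Real.pi) * ∫ v in T, Real.exp (-v ^ 2 / 2))) := by
  refine ((tendsto_betaScale_mul_betaHeight hα hβ).mul
    (tendsto_setIntegral_rescaledBeta hα hβ (fun _ => measurableSet_Iic) hT hx)).congr' ?_
  filter_upwards [eventually_gt_atTop 0] with N hN
  rw [betaCDFReal_eq_rescaledBeta hα hβ hN]

/-- Central limit theorem for the beta distribution. -/
theorem tendsto_betaCDFReal {α β : ℝ} (hα : 0 < α) (hβ : 0 < β) {x : ℕ → ℝ} {c : ℝ}
    (hx : Tendsto (fun N => (x N - α / (α + β)) / betaScale α β N) atTop (nhds c)) :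
    Tendsto (fun N : ℕ => betaCDFReal (α * N) (β * N + 1) (x N)) atTop
      (nhds (1 / √(2 * Real.pi) * ∫ v in Set.Iic c, Real.exp (-v ^ 2 / 2))) := by
  refine tendsto_betaCDFReal_of_eventually hα hβ measurableSet_Iic ?_
  filter_upwards [Measure.ae_ne volume c] with v hv
  rcases lt_or_gt_of_ne hv with h | h
  · filter_upwards [hx.eventually_const_lt h] with N hN
    simp [hN.le, h.le]
  · filter_upwards [hx.eventually_lt_const h] with N hN
    rw [Set.mem_Iic, iff_false_right h.not_ge]
    exact hN.not_ge

theorem tendsto_betaCDFReal_zero {α β : ℝ} (hα : 0 < α) (hβ : 0 < β) {x : ℕ → ℝ} {c : ℝ}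
    (hx : Tendsto x atTop (nhds c)) (hc : c < α / (α + β)) :
    Tendsto (fun N : ℕ => betaCDFReal (α * N) (β * N + 1) (x N)) atTop (nhds 0) := by
  have h : Tendsto (fun N => (x N - α / (α + β)) / betaScale α β N) atTop atBot := by
    have hN : Tendsto (fun N : ℕ => √(N : ℝ)) atTop atTop :=
      Real.tendsto_sqrt_atTop.comp tendsto_natCast_atTop_atTop
    have h1 := (hx.sub_const (α / (α + β))).div_const (√(β / (α * (α + β))) * (α / (α + β)))
    refine (h1.neg_mul_atTop (div_neg_of_neg_of_pos (sub_neg.2 hc) (by positivity)) hN).congr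
      fun N => ?_
    unfold betaScale
    rw [div_div_eq_mul_div, div_mul_eq_mul_div]
  have := tendsto_betaCDFReal_of_eventually hα hβ MeasurableSet.empty
    (Eventually.of_forall fun v => (h.eventually_lt_atBot v).mono fun N hN => by simpa using hN)
  simpa using this

theorem Ferfc_eq (r : ℝ) :
    Ferfc r = 1 / √(2 * Real.pi) * ∫ v in Set.Iic (-r), Real.exp (-v ^ 2 / 2) := by
  have h2 : (0 : ℝ) < √2 := by positivity
  have h1 := integral_comp_neg_Iic (-r) (fun v => Real.exp (-v ^ 2 / 2))
  simp only [neg_sq, neg_neg] at h1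
  have h3 := integral_comp_mul_left_Ioi' (fun v => Real.exp (-v ^ 2 / 2)) (r / √2) h2
  simp only [mul_pow, Real.sq_sqrt (zero_le_two (α := ℝ))] at h3
  rw [mul_div_cancel₀ _ h2.ne'] at h3
  rw [h1, ← h3, Ferfc, erfc, smul_eq_mul, Real.sqrt_mul zero_le_two]
  have e : (fun v : ℝ => Real.exp (-(2 * v ^ 2) / 2)) = fun v => Real.exp (-v ^ 2) := by
    ext v; congr 1; ring
  rw [e]
  have : 0 < √Real.pi := Real.sqrt_pos.2 Real.pi_pos
  field_simp

theorem qS_mul_rpow {n L y : ℝ} (hL : 0 < L) (hy : 0 < y) {N : ℕ} (hN : (N : ℝ) < n) :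
    qS n L N y * y ^ L * (1 + y) ^ (-(n + L + 1)) = 1 / (1 + y) *
      (betaCDFReal L (n + 1) (y / (1 + y)) -
        betaCDFReal (L + (N + 1)) (n + 1 - (N + 1)) (y / (1 + y))) := by
  have hy1 : 0 < 1 + y := by linarith
  have hx : y / (1 + y) ∈ Set.Ioo (0 : ℝ) 1 := ⟨by positivity, by rw [div_lt_one hy1]; linarith⟩
  have hx1 : 1 - y / (1 + y) = 1 / (1 + y) := by field_simp; ring
  have tel := Finset.sum_range_sub'
    (fun k : ℕ => betaCDFReal (L + k) (n + 1 - k) (y / (1 + y))) (N + 1)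
  simp only [Nat.cast_zero, add_zero, sub_zero, Nat.cast_add, Nat.cast_one] at tel
  rw [← tel, qS, Finset.sum_mul, Finset.sum_mul, Finset.mul_sum]
  refine Finset.sum_congr rfl fun k hk => ?_
  have hk' : (k : ℝ) ≤ N := by exact_mod_cast Nat.lt_succ_iff.1 (Finset.mem_range.1 hk)
  have hk0 : (0 : ℝ) ≤ k := k.cast_nonneg
  have h := betaCDFReal_sub_succ (show 0 < L + k by linarith) (show 0 < n - k by linarith) hx
  rw [show n - k + 1 = n + 1 - (k : ℝ) by ring] at h
  rw [show n + 1 - ((k : ℝ) + 1) = n - k by ring, ← add_assoc, h, hx1,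
    Real.div_rpow hy.le hy1.le, Real.div_rpow zero_le_one hy1.le, Real.one_rpow,
    show L + k + (n - k) + 1 = L + n + 1 by ring, add_comm (k : ℝ) L,
    Real.rpow_neg hy1.le, show n + L + 1 = (L + k) + (n - k) + 1 by ring,
    Real.rpow_add hy1, Real.rpow_add hy1, Real.rpow_add hy, Real.rpow_natCast, Real.rpow_one,
    mul_inv, mul_inv]
  ring

theorem Gamma_div_mul_rpow {n L y : ℝ} (hL : 0 < L) (hn : 0 < n) (hy : 0 < y) :
    Real.Gamma (L + n + 1) / (Real.Gamma (n + 1) * Real.Gamma L) * y ^ L *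
        (1 + y) ^ (-(n + L + 1)) =
      1 / (1 + y) * (y / (1 + y) * betaPDFReal L (n + 1) (y / (1 + y))) := by
  have hy1 : 0 < 1 + y := by linarith
  have hx : 0 < y / (1 + y) ∧ y / (1 + y) < 1 := ⟨by positivity, by rw [div_lt_one hy1]; linarith⟩
  have hx1 : 1 - y / (1 + y) = 1 / (1 + y) := by field_simp; ring
  have h1 := Real.Gamma_pos_of_pos hL
  have h2 := Real.Gamma_pos_of_pos (show 0 < n + 1 by linarith)
  have h3 := Real.Gamma_pos_of_pos (show 0 < L + n + 1 by linarith)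
  rw [betaPDFReal, if_pos hx, beta, hx1, add_sub_cancel_right, ← add_assoc,
    Real.rpow_sub_one hx.1.ne', Real.div_rpow hy.le hy1.le, Real.div_rpow zero_le_one hy1.le,
    Real.one_rpow, Real.rpow_neg hy1.le, Real.rpow_add hy1, Real.rpow_add hy1, Real.rpow_one]
  field_simp

theorem rpow_weight_eq {z w M : ℝ} (h : 0 < z * w) :
    ((1 + z ^ 2) * (1 + w ^ 2)) ^ (-M / 2) =
      (1 + z * w) ^ (-M) * Real.exp (-(M / 2 * Real.log (1 + (z - w) ^ 2 / (1 + z * w) ^ 2))) := by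
  have h1 : 0 < 1 + z * w := by linarith
  have h2 : 0 < 1 + (z - w) ^ 2 / (1 + z * w) ^ 2 := by positivity
  have e : (1 + z ^ 2) * (1 + w ^ 2) =
      (1 + z * w) ^ (2 : ℝ) * (1 + (z - w) ^ 2 / (1 + z * w) ^ 2) := by
    rw [Real.rpow_two]
    field_simp
    ring
  rw [e, Real.mul_rpow (by positivity) h2.le, ← Real.rpow_mul h1.le, Real.rpow_def_of_pos h2]
  congr 2 <;> ring

theorem tendsto_rpow_weight {M ε y : ℕ → ℝ} {p s t : ℝ} (hε0 : Tendsto ε atTop (nhds 0))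
    (hε2 : ∀ᶠ N in atTop, M N * ε N ^ 2 = (1 + p ^ 2) ^ 2)
    (hy : Tendsto y atTop (nhds (p ^ 2))) :
    Tendsto (fun N => Real.exp (-(M N / 2 *
      Real.log (1 + (p - s * ε N - (p - t * ε N)) ^ 2 / (1 + y N) ^ 2)))) atTop
      (nhds (Real.exp (-(s - t) ^ 2 / 2))) := by
  have hp : 0 < 1 + p ^ 2 := by positivity
  set D : ℕ → ℝ := fun N => (p - s * ε N - (p - t * ε N)) ^ 2 / (1 + y N) ^ 2 with hD
  have hy1 : Tendsto (fun N => (1 + y N) ^ 2) atTop (nhds ((1 + p ^ 2) ^ 2)) :=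
    (hy.const_add 1).pow 2
  have hD0 : Tendsto D atTop (nhds 0) := by
    have h1 := (((hε0.const_mul s).const_sub p).sub ((hε0.const_mul t).const_sub p)).pow 2
    simpa [hD, Pi.div_def] using h1.div hy1 (by positivity)
  have hMD : Tendsto (fun N => M N / 2 * D N) atTop (nhds ((s - t) ^ 2 / 2)) := by
    have h1 := (tendsto_const_nhds (x := (s - t) ^ 2 / 2 * (1 + p ^ 2) ^ 2)).div hy1 (by positivity)
    rw [mul_div_cancel_right₀ _ (by positivity)] at h1
    refine h1.congr' ?_
    filter_upwards [hε2] with N hN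
    rw [Pi.div_apply, ← hN, hD]
    ring
  have hMD2 : Tendsto (fun N => M N / 2 * D N ^ 2) atTop (nhds 0) := by
    have := hMD.mul hD0
    rw [mul_zero] at this
    exact this.congr fun N => by ring
  have h := (tendsto_mul_log_one_add_sub hD0 hMD2).add hMD
  have h' := h.neg.rexp
  rw [show -(-0 / 2 + (s - t) ^ 2 / 2) = -(s - t) ^ 2 / 2 by ring] at h'
  exact h'.congr fun N => by congr 2; ring

/-- Inner-edge scaling limit, in the strongly non-unitary regime, of the weighted
truncated sum `q̂ · ω̂` arising from the induced spherical unitary ensemble. -/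
theorem qhat_inner_edge_limit (a b : ℝ) (ha : 0 < a) (hb : 0 < b)
    (s t χ : ℝ) (hχ : χ ≠ 0) :
    Tendsto (fun N : ℕ =>
      let p : ℝ := Real.sqrt (a / (b + 1))
      let LN : ℝ := a * N
      let nN : ℝ := (b + 1) * N
      let δN : ℝ := (nN + LN + 1) / (N * (1 + p ^ 2) ^ 2)
      let zN : ℝ := p - s / Real.sqrt (N * δN)
      let wN : ℝ := p - t / Real.sqrt (N * δN)
      let lamN : ℝ := p - χ / Real.sqrt (N * δN)
      qhat nN LN (N - 1) (zN * wN) (lamN ^ 2) * (zN * wN) ^ LN *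
        ((1 + zN ^ 2) * (1 + wN ^ 2)) ^ (-(nN + LN + 1) / 2))
      atTop
      (nhds ((Real.exp (-(s - t) ^ 2 / 2) / (1 + Real.sqrt (a / (b + 1)) ^ 2)) *
        (Ferfc (s + t) -
          (1 / (2 * χ)) * Real.exp (-(s + t) ^ 2 / 2) / Real.sqrt (2 * Real.pi)))) := by
  have hb1 : 0 < b + 1 := by linarith
  obtain ⟨p, hp, rfl⟩ : ∃ p : ℝ, 0 < p ∧ a = p ^ 2 * (b + 1) :=
    ⟨√(a / (b + 1)), by positivity, by rw [Real.sq_sqrt (by positivity)]; field_simp⟩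
  rw [mul_div_cancel_right₀ _ hb1.ne', Real.sqrt_sq hp.le]
  dsimp only
  have hq : 0 < 1 + p ^ 2 := by positivity
  set κ := √((b + 1) * (1 + p ^ 2)) with hκ
  have hκ0 : 0 < κ := by positivity
  have hκ2 : κ ^ 2 = (b + 1) * (1 + p ^ 2) := Real.sq_sqrt (by positivity)
  have hm : p ^ 2 * (b + 1) / (p ^ 2 * (b + 1) + (b + 1)) = p ^ 2 / (1 + p ^ 2) := by
    field_simp
    ring
  set M : ℕ → ℝ := fun N => (b + 1) * N + p ^ 2 * (b + 1) * N + 1 with hM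
  have hM0 (N : ℕ) : 0 < M N := by positivity
  set ε : ℕ → ℝ := fun N => (1 + p ^ 2) / √(M N) with hε
  have hε2 (N : ℕ) : M N * ε N ^ 2 = (1 + p ^ 2) ^ 2 := by
    rw [hε, div_pow, Real.sq_sqrt (hM0 N).le, mul_div_cancel₀ _ (hM0 N).ne']
  have hρ : Tendsto (fun N : ℕ => √(N : ℝ) * ε N) atTop (nhds ((1 + p ^ 2) / κ)) := by
    have h1 : Tendsto (fun N : ℕ => √((b + 1) * (1 + p ^ 2) + 1 / (N : ℝ))) atTop (nhds κ) := by
      have := (tendsto_one_div_atTop_nhds_zero_nat (𝕜 := ℝ)).const_add ((b + 1) * (1 + p ^ 2))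
      rw [add_zero] at this
      exact this.sqrt
    refine ((tendsto_const_nhds (x := 1 + p ^ 2)).div h1 hκ0.ne').congr' ?_
    filter_upwards [eventually_gt_atTop 0] with N hN
    have hN' : (0 : ℝ) < N := by exact_mod_cast hN
    have e : (b + 1) * (1 + p ^ 2) + 1 / (N : ℝ) = M N / N := by
      rw [hM]
      field_simp
    have h3 := Real.sqrt_pos.2 (hM0 N)
    have h4 := Real.sqrt_pos.2 hN'
    rw [Pi.div_apply, e, Real.sqrt_div (hM0 N).le, hε]
    field_simp
  have hsN : Tendsto (fun N : ℕ => √(N : ℝ)) atTop atTop :=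
    Real.tendsto_sqrt_atTop.comp tendsto_natCast_atTop_atTop
  have hε0 : Tendsto ε atTop (nhds 0) := by
    refine (hρ.div_atTop hsN).congr' ?_
    filter_upwards [eventually_gt_atTop 0] with N hN
    have h4 : 0 < √(N : ℝ) := Real.sqrt_pos.2 (by exact_mod_cast hN)
    rw [mul_div_cancel_left₀ _ h4.ne']
  have hlin (c : ℝ) : Tendsto (fun N => p - c * ε N) atTop (nhds p) := by
    simpa using (hε0.const_mul c).const_sub p
  set y : ℕ → ℝ := fun N => (p - s * ε N) * (p - t * ε N) with hydef
  have hy : Tendsto y atTop (nhds (p ^ 2)) := by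
    rw [sq]
    exact (hlin s).mul (hlin t)
  have hy1 : Tendsto (fun N => 1 + y N) atTop (nhds (1 + p ^ 2)) := hy.const_add 1
  have hx : Tendsto (fun N => y N / (1 + y N)) atTop (nhds (p ^ 2 / (1 + p ^ 2))) :=
    hy.div hy1 hq.ne'
  have hypos : ∀ᶠ N in atTop, 0 < y N := hy.eventually_const_lt (by positivity)
  set r : ℕ → ℝ := betaScale (p ^ 2 * (b + 1)) (b + 1) with hr
  have hrN (N : ℕ) : r N = p / (κ * (1 + p ^ 2)) / √N := by
    rw [hr, betaScale, hm, show (b + 1) / (p ^ 2 * (b + 1) * (p ^ 2 * (b + 1) + (b + 1))) =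
      (1 / (p * κ)) ^ 2 by rw [div_pow, mul_pow, hκ2]; field_simp; ring,
      Real.sqrt_sq (by positivity)]
    congr 1
    field_simp
  have hc : Tendsto (fun N => (y N / (1 + y N) - p ^ 2 * (b + 1) / (p ^ 2 * (b + 1) + (b + 1))) / r N)
      atTop (nhds (-(s + t))) := by
    have h1 : Tendsto (fun N : ℕ => (√(N : ℝ) * ε N) * (-p * (s + t) + s * t * ε N) /
        ((1 + y N) * (1 + p ^ 2)) / (p / (κ * (1 + p ^ 2)))) atTop (nhds (-(s + t))) := by
      have h2 := ((hρ.mul ((hε0.const_mul (s * t)).const_add (-p * (s + t)))).div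
        (hy1.mul_const (1 + p ^ 2)) (by positivity)).div_const (p / (κ * (1 + p ^ 2)))
      convert! h2 using 2
      field_simp
      ring
    refine h1.congr' ?_
    filter_upwards [eventually_gt_atTop 0, hypos] with N hN hyN
    have hN' : (0 : ℝ) < N := by exact_mod_cast hN
    have h4 := Real.sqrt_pos.2 hN'
    have h5 : 0 < 1 + y N := by linarith
    have e : y N = p ^ 2 + ε N * (-p * (s + t) + s * t * ε N) := by rw [hydef]; ring
    have e2 : y N / (1 + y N) - p ^ 2 / (1 + p ^ 2) =
        ε N * (-p * (s + t) + s * t * ε N) / ((1 + y N) * (1 + p ^ 2)) := by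
      rw [div_sub_div _ _ h5.ne' hq.ne']
      congr 1
      linear_combination e
    rw [hm, hrN, e2]
    field_simp
  have ha1 : 0 < p ^ 2 * (b + 1) := by positivity
  have hC1 := tendsto_betaCDFReal ha1 hb1 hc
  have hC2 := tendsto_betaCDFReal_zero (show 0 < p ^ 2 * (b + 1) + 1 by positivity) hb hx (by
    rw [div_lt_div_iff₀ hq (by positivity)]
    nlinarith)
  have hP := tendsto_betaScale_mul_betaPDFReal ha1 hb1 hc
  have hden : Tendsto (fun N => r N * ((b + 1) * N * (p - χ * ε N) ^ 2 - p ^ 2 * (b + 1) * N)) atTop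
      (nhds (-(2 * χ) * (p ^ 2 / (1 + p ^ 2)))) := by
    have h1 := ((hρ.mul ((hε0.const_mul (χ ^ 2)).const_add (-2 * p * χ))).const_mul
      (p / (κ * (1 + p ^ 2)) * (b + 1)))
    have e : p / (κ * (1 + p ^ 2)) * (b + 1) * ((1 + p ^ 2) / κ * (-2 * p * χ + χ ^ 2 * 0)) =
        -(2 * χ) * (p ^ 2 / (1 + p ^ 2)) := by
      field_simp
      rw [hκ2]
      ring
    rw [e] at h1
    refine h1.congr' ?_
    filter_upwards [eventually_gt_atTop 0] with N hN
    have hN' : (0 : ℝ) < N := by exact_mod_cast hN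
    have h4 := Real.sqrt_pos.2 hN'
    have h5 := Real.sq_sqrt hN'.le
    rw [hrN]
    field_simp
    linear_combination χ * ε N * (χ * ε N - 2 * p) * h5
  have hm0 : p ^ 2 / (1 + p ^ 2) ≠ 0 := by positivity
  have hQ := (hx.mul hP).div hden (by simp [hχ, hm0])
  have hW := tendsto_rpow_weight (s := s) (t := t) hε0 (Eventually.of_forall hε2) hy
  have key := hW.mul (((tendsto_const_nhds (x := (1 : ℝ))).div hy1 hq.ne').mul
    ((hC1.sub hC2).add hQ))
  rw [← Ferfc_eq] at key
  convert! key.congr' ?_ using 2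
  · rw [neg_sq]
    field_simp
    ring
  filter_upwards [eventually_gt_atTop 0, hypos] with N hN hyN
  have hN' : (0 : ℝ) < N := by exact_mod_cast hN
  have hrpos : 0 < r N := betaScale_pos ha1 hb1 hN
  have hsqrt (c : ℝ) : c / √(N * (((b + 1) * N + p ^ 2 * (b + 1) * N + 1) / (N * (1 + p ^ 2) ^ 2))) =
      c * ε N := by
    rw [show N * (((b + 1) * N + p ^ 2 * (b + 1) * N + 1) / (N * (1 + p ^ 2) ^ 2)) =
      M N / (1 + p ^ 2) ^ 2 by rw [hM]; field_simp, Real.sqrt_div (hM0 N).le, Real.sqrt_sq hq.le,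
      hε, div_div_eq_mul_div, mul_div_assoc]
  have hcast : ((N - 1 : ℕ) : ℝ) + 1 = N := by
    rw [Nat.cast_sub hN, Nat.cast_one, sub_add_cancel]
  have hlt : ((N - 1 : ℕ) : ℝ) < (b + 1) * N := by nlinarith
  have hA := qS_mul_rpow (show 0 < p ^ 2 * (b + 1) * N by positivity) hyN hlt
  have hB := Gamma_div_mul_rpow (show 0 < p ^ 2 * (b + 1) * N by positivity)
    (show 0 < (b + 1) * N by positivity) hyN
  rw [hcast, show p ^ 2 * (b + 1) * N + N = (p ^ 2 * (b + 1) + 1) * N by ring,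
    show (b + 1) * N + 1 - N = b * N + 1 by ring] at hA
  simp only [hsqrt]
  rw [rpow_weight_eq hyN, qhat]
  change _ * (1 / (1 + y N) * (_ + y N / (1 + y N) * (r N * _) / (r N * _))) = _
  rw [mul_left_comm _ (r N), mul_div_mul_left _ _ hrpos.ne', mul_add, ← hA,
    ← mul_div_assoc (1 / (1 + y N)), ← hB]
  ring
end
end
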